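/- arXiv:2003.02696 — 2 statements merged into one kernel-verified Lean document; each statement's English description precedes it below -/
import Mathlib

section
/- Let ϑ̄ ∈ C([0,1])ⁿ, ε > 0, and let K > 0 satisfy K < c_p^{-2} = π²/4. Then there exists γ* = γ*(ϑ̄, ε, K) such that for every γ > γ* there is a unique solution of the Euler–Lagrange system (EQ) in the set {(h,α,ϑ,λ) ∈ 𝓗 × H^1_{0L}(I)ⁿ : max_{i=1,…,n}|h_i| ≤ K}. Moreover, this solution satisfies ‖ϑ_i‖_∞ ≤ |h_i| for all i = 1,…,n. -/
open MeasureTheory Set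

noncomputable def edot (p q : ℝ × ℝ) : ℝ := p.1 * q.1 + p.2 * q.2
noncomputable def enorm2 (p : ℝ × ℝ) : ℝ := Real.sqrt (p.1 ^ 2 + p.2 ^ 2)
noncomputable def Dmvec (v : ℝ) : ℝ × ℝ := (-Real.sin v, Real.cos v)
noncomputable def D2mvec (v : ℝ) : ℝ × ℝ := (-Real.cos v, -Real.sin v)

noncomputable def mu01 : Measure ℝ := volume.restrict (Ioo 0 1)

/-- `H^1_{0L}(I)` modelled isometrically by the `L²(I)` space of derivatives. -/
noncomputable abbrev E := Lp ℝ 2 mu01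

noncomputable def U (g : E) : ℝ → ℝ := fun t => ∫ s in Ioc 0 t, (g : ℝ → ℝ) s ∂mu01

/-- Weak solution of the state equation `(P_ϑ)` with design the raw function `α`. -/
def IsStateSolF (α : ℝ → ℝ) (p : ℝ × ℝ) (g : E) : Prop :=
  ∀ w : E, (∫ s, (g : ℝ → ℝ) s * (w : ℝ → ℝ) s ∂mu01)
    - (∫ s, edot p (Dmvec (α s + U g s)) * U w s ∂mu01) = 0

/-- Weak solution of the adjoint equation `(P_λ)`. -/
def IsAdjSolF (α : ℝ → ℝ) (p : ℝ × ℝ) (g : E) (tbi : ℝ → ℝ) (l : E) : Prop :=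
  ∀ w : E, (∫ s, (l : ℝ → ℝ) s * (w : ℝ → ℝ) s ∂mu01)
    - (∫ s, U l s * edot p (D2mvec (α s + U g s)) * U w s ∂mu01)
    = ∫ s, (U g s - tbi s) * U w s ∂mu01

/-- The value `T_i^{(α)}(h) = −(1/γ)∫₀¹ λᵢ Dm(α+ϑᵢ)` of the chain map. -/
noncomputable def Tval (γ : ℝ) (α : ℝ → ℝ) (g l : E) : ℝ × ℝ :=
  (-(1 / γ) * ∫ s, U l s * (Dmvec (α s + U g s)).1 ∂mu01,
   -(1 / γ) * ∫ s, U l s * (Dmvec (α s + U g s)).2 ∂mu01)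

/-- The Euler–Lagrange (Lagrange-multiplier) system (EQ), in weak form, for the
quadruplet `(h, α, ϑ, λ)` (designs and states in derivative representation). -/
def SolEQ {n : ℕ} (tb : Fin n → ℝ → ℝ) (ε γ : ℝ)
    (h : Fin n → ℝ × ℝ) (a : E) (th l : Fin n → E) : Prop :=
  -- the state equations `(P_{ϑᵢ})`:
  (∀ i, IsStateSolF (U a) (h i) (th i)) ∧
  -- the adjoint equations `(P_{λᵢ})`:
  (∀ i, IsAdjSolF (U a) (h i) (th i) (tb i) (l i)) ∧
  -- the design equation `(P_α)`:
  (∀ w : E, ε * (∫ s, (a : ℝ → ℝ) s * (w : ℝ → ℝ) s ∂mu01)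
    + ∑ i, (∫ s, U (l i) s * edot (h i) (D2mvec (U a s + U (th i) s))
        * U w s ∂mu01) = 0) ∧
  -- the control equations `(P_{hᵢ})`: `γ hᵢ = −∫₀¹ λᵢ Dm(α+ϑᵢ)`:
  (∀ i, γ * (h i).1 = -(∫ s, U (l i) s * (Dmvec (U a s + U (th i) s)).1 ∂mu01) ∧
        γ * (h i).2 = -(∫ s, U (l i) s * (Dmvec (U a s + U (th i) s)).2 ∂mu01))

instance : IsProbabilityMeasure mu01 := ⟨by simp [mu01]⟩

instance : NullSingletonClass mu01 := by unfold mu01; infer_instance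

/-! ### The primitive operator -/

lemma U_eq_inner (g : E) (t : ℝ) :
    U g t = inner ℝ (indicatorConstLp (μ := mu01) (s := Ioc 0 t) 2 measurableSet_Ioc
      (measure_ne_top _ _) (1 : ℝ)) g :=
  (L2.inner_indicatorConstLp_one measurableSet_Ioc (measure_ne_top _ _) g).symm

lemma U_add (g h : E) (t : ℝ) : U (g + h) t = U g t + U h t := by
  simp only [U_eq_inner, inner_add_right]

lemma U_sub (g h : E) (t : ℝ) : U (g - h) t = U g t - U h t := by
  simp only [U_eq_inner, inner_sub_right]

lemma U_smul (c : ℝ) (g : E) (t : ℝ) : U (c • g) t = c * U g t := by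
  simp only [U_eq_inner, inner_smul_right]

@[simp] lemma U_zero (t : ℝ) : U 0 t = 0 := by
  simp only [U_eq_inner, inner_zero_right]

lemma abs_U_le (g : E) (t : ℝ) : |U g t| ≤ ‖g‖ := by
  rw [U_eq_inner]
  refine (abs_real_inner_le_norm _ _).trans ?_
  refine mul_le_of_le_one_left (norm_nonneg _) (norm_indicatorConstLp_le.trans ?_)
  rw [norm_one, one_mul]
  exact Real.rpow_le_one measureReal_nonneg measureReal_le_one (by positivity)

lemma abs_U_sub_le (g h : E) (t : ℝ) : |U g t - U h t| ≤ ‖g - h‖ := by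
  rw [← U_sub]
  exact abs_U_le _ t

lemma continuous_U (g : E) : Continuous (U g) := by
  have hg : Integrable g mu01 := (Lp.memLp g).integrable (by norm_num)
  have hc : Continuous fun t => ∫ s in (0 : ℝ)..t, g s ∂mu01 :=
    intervalIntegral.continuous_primitive (fun a b => hg.intervalIntegrable) 0
  have hU : U g = fun t => ∫ s in (0 : ℝ)..max 0 t, g s ∂mu01 := by
    funext t
    rw [intervalIntegral.integral_of_le (le_max_left _ _), U]
    rcases le_total t 0 with ht | ht
    · simp [ht]
    · rw [max_eq_right ht]
  rw [hU]
  exact hc.comp (by fun_prop)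

lemma memLp_of_continuous {f : ℝ → ℝ} (hf : Continuous f) {C : ℝ} (hC : ∀ s, |f s| ≤ C) :
    MemLp f 2 mu01 :=
  MemLp.of_bound hf.aestronglyMeasurable C (.of_forall hC)

lemma memLp_U (g : E) : MemLp (U g) 2 mu01 :=
  memLp_of_continuous (continuous_U g) (abs_U_le g)

/-! ### The sharp Poincaré inequality -/

lemma sq_lintegral_le_mul {μ : Measure ℝ} {f c : ℝ → ENNReal} (hf : AEMeasurable f μ)
    (hc : AEMeasurable c μ) (h0 : ∀ᵐ s ∂μ, c s ≠ 0) (htop : ∀ᵐ s ∂μ, c s ≠ ⊤) :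
    (∫⁻ s, f s ∂μ) ^ 2 ≤ (∫⁻ s, c s ^ 2 ∂μ) * ∫⁻ s, f s ^ 2 / c s ^ 2 ∂μ := by
  have hol := ENNReal.lintegral_mul_le_Lp_mul_Lq μ Real.HolderConjugate.two_two hc (hf.div hc)
  have hE : ∫⁻ s, (c * (f / c)) s ∂μ = ∫⁻ s, f s ∂μ := by
    refine lintegral_congr_ae ?_
    filter_upwards [h0, htop] with s h0 h1
    exact ENNReal.mul_div_cancel h0 h1
  have hsq : ∀ x : ENNReal, (x ^ (1 / (2 : ℝ))) ^ 2 = x := fun x => by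
    rw [← ENNReal.rpow_natCast, ← ENNReal.rpow_mul]; norm_num
  rw [hE] at hol
  refine (pow_le_pow_left₀ zero_le hol 2).trans ?_
  rw [mul_pow, hsq, hsq]
  simp only [Pi.div_apply, ENNReal.rpow_two, ENNReal.div_eq_inv_mul, mul_pow, ENNReal.inv_pow]
  exact le_rfl

lemma setLIntegral_cos_le {t : ℝ} (ht : t ∈ Ioo (0 : ℝ) 1) :
    ∫⁻ s in Ioc 0 t, ENNReal.ofReal (Real.cos (Real.pi / 2 * s)) ∂mu01
      ≤ ENNReal.ofReal (2 / Real.pi * Real.sin (Real.pi / 2 * t)) := by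
  have hpi := Real.pi_pos
  have hi : ∫ s in (0 : ℝ)..t, Real.cos (Real.pi / 2 * s)
      = 2 / Real.pi * Real.sin (Real.pi / 2 * t) := by
    rw [intervalIntegral.integral_comp_mul_left _ (by positivity)]
    simp
  calc _ ≤ ∫⁻ s in Ioc 0 t, ENNReal.ofReal (Real.cos (Real.pi / 2 * s)) := by
        refine lintegral_mono' (Measure.restrict_mono le_rfl ?_) le_rfl
        exact Measure.restrict_le_self
    _ = _ := by
        rw [← hi, intervalIntegral.integral_of_le ht.1.le, ofReal_integral_eq_lintegral_ofReal]
        · exact (Continuous.integrableOn_Icc (by fun_prop)).mono_set Ioc_subset_Icc_self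
        · refine ae_restrict_of_forall_mem measurableSet_Ioc fun s hs => ?_
          exact Real.cos_nonneg_of_mem_Icc
            ⟨by nlinarith [hs.1], by nlinarith [hs.2, ht.2]⟩

lemma setLIntegral_sin_le {s : ℝ} (hs : s ∈ Ioo (0 : ℝ) 1) :
    ∫⁻ t in Ici s, ENNReal.ofReal (2 / Real.pi * Real.sin (Real.pi / 2 * t)) ∂mu01
      ≤ ENNReal.ofReal (4 / Real.pi ^ 2) * ENNReal.ofReal (Real.cos (Real.pi / 2 * s)) := by
  have hpi := Real.pi_pos
  have hi : ∫ t in s..1, 2 / Real.pi * Real.sin (Real.pi / 2 * t)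
      = 4 / Real.pi ^ 2 * Real.cos (Real.pi / 2 * s) := by
    rw [intervalIntegral.integral_const_mul,
      intervalIntegral.integral_comp_mul_left _ (by positivity)]
    simp
    field_simp
    norm_num
    ring
  calc _ ≤ ∫⁻ t in Icc s 1, ENNReal.ofReal (2 / Real.pi * Real.sin (Real.pi / 2 * t)) := by
        rw [mu01, Measure.restrict_restrict measurableSet_Ici]
        refine lintegral_mono' (Measure.restrict_mono ?_ le_rfl) le_rfl
        exact fun x hx => ⟨hx.1, hx.2.2.le⟩
    _ = _ := by
        rw [← ENNReal.ofReal_mul (by positivity), ← hi, intervalIntegral.integral_of_le hs.2.le,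
          ← integral_Icc_eq_integral_Ioc, ofReal_integral_eq_lintegral_ofReal]
        · exact Continuous.integrableOn_Icc (by fun_prop)
        · refine ae_restrict_of_forall_mem measurableSet_Icc fun t ht => ?_
          refine mul_nonneg (by positivity) (Real.sin_nonneg_of_mem_Icc ⟨?_, ?_⟩)
          · have := hs.1.trans_le ht.1
            positivity
          · nlinarith [ht.2]

lemma ae_mem_Ioo : ∀ᵐ s ∂mu01, s ∈ Ioo (0 : ℝ) 1 :=
  ae_restrict_mem measurableSet_Ioo

lemma cos_pi_half_mul_pos {s : ℝ} (hs : s ∈ Ioo (0 : ℝ) 1) : 0 < Real.cos (Real.pi / 2 * s) :=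
  Real.cos_pos_of_mem_Ioo
    ⟨by nlinarith [hs.1, Real.pi_pos], by nlinarith [hs.2, Real.pi_pos]⟩

/-- The sharp Poincaré inequality for functions vanishing at the left endpoint, by a weighted
Cauchy–Schwarz inequality with the first eigenfunction as weight. -/
lemma lintegral_U_sq_le (g : E) :
    ∫⁻ t, ‖U g t‖ₑ ^ 2 ∂mu01 ≤ ENNReal.ofReal (4 / Real.pi ^ 2) * ∫⁻ s, ‖g s‖ₑ ^ 2 ∂mu01 := by
  set φ : ℝ → ENNReal := fun s => ENNReal.ofReal (Real.cos (Real.pi / 2 * s)) with hφ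
  set ψ : ℝ → ENNReal :=
    fun t => ENNReal.ofReal (2 / Real.pi * Real.sin (Real.pi / 2 * t)) with hψ
  have hφm : Measurable φ := by fun_prop
  have hψm : Measurable ψ := by fun_prop
  have hg : StronglyMeasurable (g : ℝ → ℝ) := Lp.stronglyMeasurable g
  have hgm : Measurable fun s => ‖g s‖ₑ := hg.enorm
  have hφ0 : ∀ᵐ s ∂mu01, φ s ≠ 0 := by
    filter_upwards [ae_mem_Ioo] with s hs
    simpa [hφ] using cos_pi_half_mul_pos hs
  have hφt : ∀ s, φ s ≠ ⊤ := fun s => ENNReal.ofReal_ne_top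
  have hsqrt : ∀ x : ENNReal, (x ^ (1 / (2 : ℝ))) ^ 2 = x := fun x => by
    rw [← ENNReal.rpow_natCast, ← ENNReal.rpow_mul]; norm_num
  have hpt : ∀ t ∈ Ioo (0 : ℝ) 1, ‖U g t‖ₑ ^ 2
      ≤ ψ t * ∫⁻ s in Ioc 0 t, ‖g s‖ₑ ^ 2 / φ s ∂mu01 := by
    intro t ht
    calc ‖U g t‖ₑ ^ 2 ≤ (∫⁻ s in Ioc 0 t, ‖g s‖ₑ ∂mu01) ^ 2 :=
          pow_le_pow_left₀ zero_le (enorm_integral_le_lintegral_enorm _) 2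
      _ ≤ (∫⁻ s in Ioc 0 t, φ s ∂mu01) * ∫⁻ s in Ioc 0 t, ‖g s‖ₑ ^ 2 / φ s ∂mu01 := by
          have := sq_lintegral_le_mul (μ := mu01.restrict (Ioc 0 t)) hgm.aemeasurable
            (c := fun s => φ s ^ (1 / (2 : ℝ))) (hφm.pow_const _).aemeasurable
            (by
              filter_upwards [ae_restrict_of_ae hφ0] with s hs
              simp [ENNReal.rpow_eq_zero_iff, hs])
            (.of_forall fun s => by simp [ENNReal.rpow_eq_top_iff, hφt])
          simpa only [hsqrt] using this
      _ ≤ _ := by gcongr; exact setLIntegral_cos_le ht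
  calc ∫⁻ t, ‖U g t‖ₑ ^ 2 ∂mu01
      ≤ ∫⁻ t, ∫⁻ s, (Ici s).indicator ψ t * (‖g s‖ₑ ^ 2 / φ s) ∂mu01 ∂mu01 := by
        refine lintegral_mono_ae ?_
        filter_upwards [ae_mem_Ioo] with t ht
        refine (hpt t ht).trans ?_
        rw [← lintegral_const_mul' _ _ ENNReal.ofReal_ne_top, ← lintegral_indicator measurableSet_Ioc]
        refine lintegral_mono fun s => ?_
        by_cases hs : s ∈ Ioc 0 t
        · rw [indicator_of_mem hs, indicator_of_mem (show t ∈ Ici s from hs.2)]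
        · rw [indicator_of_notMem hs]
          exact zero_le
    _ = ∫⁻ s, ∫⁻ t, (Ici s).indicator ψ t * (‖g s‖ₑ ^ 2 / φ s) ∂mu01 ∂mu01 := by
        refine lintegral_lintegral_swap (Measurable.aemeasurable ?_)
        have : Measurable fun p : ℝ × ℝ => {q : ℝ × ℝ | q.2 ≤ q.1}.indicator (fun q => ψ q.1) p :=
          (hψm.comp measurable_fst).indicator (measurableSet_le measurable_snd measurable_fst)
        refine Measurable.mul (g := fun p : ℝ × ℝ => ‖g p.2‖ₑ ^ 2 / φ p.2) this ?_
        exact ((hgm.pow_const 2).div hφm).comp measurable_snd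
    _ ≤ ∫⁻ s, ENNReal.ofReal (4 / Real.pi ^ 2) * ‖g s‖ₑ ^ 2 ∂mu01 := by
        refine lintegral_mono_ae ?_
        filter_upwards [ae_mem_Ioo, hφ0] with s hs h0
        rw [lintegral_mul_const _ (hψm.indicator measurableSet_Ici),
          lintegral_indicator measurableSet_Ici]
        calc _ ≤ ENNReal.ofReal (4 / Real.pi ^ 2) * φ s * (‖g s‖ₑ ^ 2 / φ s) := by
              gcongr; exact setLIntegral_sin_le hs
          _ = _ := by rw [mul_assoc, ENNReal.mul_div_cancel h0 (hφt s)]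
    _ = _ := lintegral_const_mul' _ _ ENNReal.ofReal_ne_top

lemma enorm_sq_eq_lintegral (g : E) : ‖g‖ₑ ^ 2 = ∫⁻ s, ‖g s‖ₑ ^ 2 ∂mu01 := by
  rw [Lp.enorm_def]
  have := eLpNorm_nnreal_pow_eq_lintegral (μ := mu01) (f := g) (p := 2) two_ne_zero
  simpa using this

lemma norm_toLp_U_le (g : E) : ‖(memLp_U g).toLp (U g)‖ ≤ 2 / Real.pi * ‖g‖ := by
  have hpi := Real.pi_pos
  have h : ‖(memLp_U g).toLp (U g)‖ₑ ^ 2 ≤ ENNReal.ofReal (4 / Real.pi ^ 2) * ‖g‖ₑ ^ 2 := by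
    rw [enorm_sq_eq_lintegral, enorm_sq_eq_lintegral]
    refine le_of_eq_of_le (lintegral_congr_ae ?_) (lintegral_U_sq_le g)
    filter_upwards [(memLp_U g).coeFn_toLp] with s hs
    rw [hs]
  rw [← ofReal_norm, ← ofReal_norm, ← ENNReal.ofReal_pow (norm_nonneg _),
    ← ENNReal.ofReal_pow (norm_nonneg _), ← ENNReal.ofReal_mul (by positivity),
    ENNReal.ofReal_le_ofReal_iff (by positivity)] at h
  refine (sq_le_sq₀ (norm_nonneg _) (by positivity)).1 ?_
  calc _ ≤ _ := h
    _ = _ := by ring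

/-- The primitive operator as a bounded operator on `L²`. -/
noncomputable def primitiveCLM : E →L[ℝ] E :=
  LinearMap.mkContinuous
    { toFun := fun g => (memLp_U g).toLp (U g)
      map_add' := fun g h => by
        rw [← MemLp.toLp_add]
        exact MemLp.toLp_congr _ _ (.of_forall (U_add g h))
      map_smul' := fun c g => by
        rw [RingHom.id_apply, ← MemLp.toLp_const_smul]
        exact MemLp.toLp_congr _ _ (.of_forall (U_smul c g)) }
    (2 / Real.pi) norm_toLp_U_le

lemma primitiveCLM_apply (g : E) : primitiveCLM g = (memLp_U g).toLp (U g) := rfl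

lemma norm_primitiveCLM_le : ‖primitiveCLM‖ ≤ 2 / Real.pi :=
  LinearMap.mkContinuous_norm_le _ (by positivity) _

/-! ### The solution operator of the Poisson problem -/

/-- The derivative of the weak solution of the Poisson problem with source `f`, Dirichlet condition
at `0` and Neumann condition at `1`; the junk value for `f ∉ L²` is `0`. -/
noncomputable def poissonSol (f : ℝ → ℝ) : E :=
  open Classical in
  ContinuousLinearMap.adjoint primitiveCLM (if hf : MemLp f 2 mu01 then hf.toLp f else 0)

lemma poissonSol_of_memLp {f : ℝ → ℝ} (hf : MemLp f 2 mu01) :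
    poissonSol f = ContinuousLinearMap.adjoint primitiveCLM (hf.toLp f) := by
  rw [poissonSol, dif_pos hf]

lemma inner_eq_integral_mul (g w : E) : inner ℝ g w = ∫ s, g s * w s ∂mu01 := by
  rw [L2.inner_def]
  exact integral_congr_ae (.of_forall fun s => mul_comm _ _)

lemma inner_poissonSol {f : ℝ → ℝ} (hf : MemLp f 2 mu01) (w : E) :
    inner ℝ (poissonSol f) w = ∫ s, f s * U w s ∂mu01 := by
  rw [poissonSol_of_memLp hf, ContinuousLinearMap.adjoint_inner_left, primitiveCLM_apply,
    inner_eq_integral_mul]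
  refine integral_congr_ae ?_
  filter_upwards [hf.coeFn_toLp, (memLp_U w).coeFn_toLp] with s h1 h2
  rw [h1, h2]

lemma two_div_pi_le : 2 / Real.pi ≤ 2 / 3 := by
  have := Real.pi_gt_three
  gcongr

lemma norm_adjoint_primitiveCLM_le (f : E) :
    ‖ContinuousLinearMap.adjoint primitiveCLM f‖ ≤ 2 / Real.pi * ‖f‖ := by
  refine (ContinuousLinearMap.le_opNorm _ _).trans ?_
  rw [LinearIsometryEquiv.norm_map]
  exact mul_le_mul_of_nonneg_right norm_primitiveCLM_le (norm_nonneg _)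

lemma poissonSol_sub {f g : ℝ → ℝ} (hf : MemLp f 2 mu01) (hg : MemLp g 2 mu01) :
    poissonSol f - poissonSol g = poissonSol (f - g) := by
  rw [poissonSol_of_memLp hf, poissonSol_of_memLp hg, poissonSol_of_memLp (hf.sub hg),
    MemLp.toLp_sub, map_sub]

lemma norm_toLp_le {f : ℝ → ℝ} (hf : MemLp f 2 mu01) {C : ℝ} (h : ∀ s, |f s| ≤ C) :
    ‖hf.toLp f‖ ≤ C := by
  have hC : 0 ≤ C := (abs_nonneg _).trans (h 0)
  refine (Lp.norm_le_of_ae_bound hC ?_).trans_eq ?_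
  · filter_upwards [hf.coeFn_toLp] with s hs
    rw [hs]
    exact h s
  · simp [measureUnivNNReal]

lemma norm_poissonSol_le {f : ℝ → ℝ} (hf : MemLp f 2 mu01) {C : ℝ} (h : ∀ s, |f s| ≤ C) :
    ‖poissonSol f‖ ≤ 2 / 3 * C := by
  have hC : 0 ≤ C := (abs_nonneg _).trans (h 0)
  rw [poissonSol_of_memLp hf]
  refine (norm_adjoint_primitiveCLM_le _).trans ?_
  exact mul_le_mul two_div_pi_le (norm_toLp_le hf h) (norm_nonneg _) (by norm_num)

lemma norm_poissonSol_sub_le {f g : ℝ → ℝ} (hf : MemLp f 2 mu01) (hg : MemLp g 2 mu01) {C : ℝ}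
    (h : ∀ s, |f s - g s| ≤ C) : ‖poissonSol f - poissonSol g‖ ≤ 2 / 3 * C := by
  rw [poissonSol_sub hf hg]
  exact norm_poissonSol_le (hf.sub hg) h

/-! ### Bounds on the nonlinearities -/

lemma abs_fst_le (p : ℝ × ℝ) : |p.1| ≤ ‖p‖ := norm_fst_le p

lemma abs_snd_le (p : ℝ × ℝ) : |p.2| ≤ ‖p‖ := norm_snd_le p

lemma enorm2_Dmvec (v : ℝ) : enorm2 (Dmvec v) = 1 := by
  simp [enorm2, Dmvec]

lemma enorm2_D2mvec (v : ℝ) : enorm2 (D2mvec v) = 1 := by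
  simp [enorm2, D2mvec]

lemma abs_edot_le (p q : ℝ × ℝ) : |edot p q| ≤ enorm2 p * enorm2 q := by
  rw [enorm2, enorm2, ← Real.sqrt_mul (by positivity)]
  refine Real.abs_le_sqrt ?_
  simp only [edot]
  nlinarith [sq_nonneg (p.1 * q.2 - p.2 * q.1)]

lemma abs_edot_Dmvec_le (p : ℝ × ℝ) (v : ℝ) : |edot p (Dmvec v)| ≤ enorm2 p := by
  simpa [enorm2_Dmvec] using abs_edot_le p (Dmvec v)

lemma abs_edot_D2mvec_le (p : ℝ × ℝ) (v : ℝ) : |edot p (D2mvec v)| ≤ enorm2 p := by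
  simpa [enorm2_D2mvec] using abs_edot_le p (D2mvec v)

lemma enorm2_le (p : ℝ × ℝ) : enorm2 p ≤ 2 * ‖p‖ := by
  rw [enorm2, Real.sqrt_le_left (by positivity), ← sq_abs p.1, ← sq_abs p.2]
  nlinarith [abs_fst_le p, abs_snd_le p, abs_nonneg p.1, abs_nonneg p.2]

lemma abs_edot_sub_le (p p' q q' : ℝ × ℝ) :
    |edot p q - edot p' q'| ≤ |edot (p - p') q| + 2 * ‖p'‖ * ‖q - q'‖ := by
  have h1 : edot p q - edot p' q' = edot (p - p') q + (p'.1 * (q - q').1 + p'.2 * (q - q').2) := by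
    simp only [edot, Prod.fst_sub, Prod.snd_sub]; ring
  have h2 : |p'.1 * (q - q').1| ≤ ‖p'‖ * ‖q - q'‖ := by
    rw [abs_mul]
    exact mul_le_mul (abs_fst_le _) (abs_fst_le _) (abs_nonneg _) (norm_nonneg _)
  have h3 : |p'.2 * (q - q').2| ≤ ‖p'‖ * ‖q - q'‖ := by
    rw [abs_mul]
    exact mul_le_mul (abs_snd_le _) (abs_snd_le _) (abs_nonneg _) (norm_nonneg _)
  rw [h1]
  refine (abs_add_le _ _).trans ?_
  linarith [abs_add_le (p'.1 * (q - q').1) (p'.2 * (q - q').2)]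

lemma abs_sin_sub_sin_le (v w : ℝ) : |Real.sin v - Real.sin w| ≤ |v - w| := by
  simpa [Real.dist_eq] using Real.lipschitzWith_sin.dist_le_mul v w

lemma abs_cos_sub_cos_le (v w : ℝ) : |Real.cos v - Real.cos w| ≤ |v - w| := by
  simpa [Real.dist_eq] using Real.lipschitzWith_cos.dist_le_mul v w

lemma norm_Dmvec_sub_le (v w : ℝ) : ‖Dmvec v - Dmvec w‖ ≤ |v - w| := by
  rw [Prod.norm_def]
  refine max_le ?_ (abs_cos_sub_cos_le v w)
  simpa [Dmvec, neg_add_eq_sub, abs_sub_comm] using abs_sin_sub_sin_le v w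

lemma norm_D2mvec_sub_le (v w : ℝ) : ‖D2mvec v - D2mvec w‖ ≤ |v - w| := by
  rw [Prod.norm_def]
  refine max_le ?_ ?_
  · simpa [D2mvec, neg_add_eq_sub, abs_sub_comm] using abs_cos_sub_cos_le v w
  · simpa [D2mvec, neg_add_eq_sub, abs_sub_comm] using abs_sin_sub_sin_le v w

lemma abs_edot_Dmvec_sub_le (p p' : ℝ × ℝ) (v v' : ℝ) :
    |edot p (Dmvec v) - edot p' (Dmvec v')| ≤ 2 * ‖p - p'‖ + 2 * ‖p'‖ * |v - v'| := by
  refine (abs_edot_sub_le _ _ _ _).trans (add_le_add ?_ ?_)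
  · exact (abs_edot_Dmvec_le _ _).trans (enorm2_le _)
  · gcongr
    exact norm_Dmvec_sub_le v v'

lemma abs_edot_D2mvec_sub_le (p p' : ℝ × ℝ) (v v' : ℝ) :
    |edot p (D2mvec v) - edot p' (D2mvec v')| ≤ 2 * ‖p - p'‖ + 2 * ‖p'‖ * |v - v'| := by
  refine (abs_edot_sub_le _ _ _ _).trans (add_le_add ?_ ?_)
  · exact (abs_edot_D2mvec_le _ _).trans (enorm2_le _)
  · gcongr
    exact norm_D2mvec_sub_le v v'

lemma abs_mul_sub_mul_le (x y x' y' : ℝ) :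
    |x * y - x' * y'| ≤ |x - x'| * |y| + |x'| * |y - y'| := by
  rw [← abs_mul, ← abs_mul]
  refine le_of_eq_of_le ?_ (abs_add_le _ _)
  ring_nf

lemma memLp_stateSource (p : ℝ × ℝ) (a g : E) :
    MemLp (fun s => edot p (Dmvec (U a s + U g s))) 2 mu01 := by
  refine memLp_of_continuous ?_ (fun s => abs_edot_Dmvec_le p _)
  have := continuous_U a
  have := continuous_U g
  unfold edot Dmvec
  fun_prop

lemma memLp_adjointSource (p : ℝ × ℝ) (a g l : E) :
    MemLp (fun s => U l s * edot p (D2mvec (U a s + U g s))) 2 mu01 := by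
  refine memLp_of_continuous (C := ‖l‖ * enorm2 p) ?_ (fun s => ?_)
  · have := continuous_U a
    have := continuous_U g
    have := continuous_U l
    unfold edot D2mvec
    fun_prop
  · rw [abs_mul]
    exact mul_le_mul (abs_U_le l s) (abs_edot_D2mvec_le p _) (abs_nonneg _) (norm_nonneg _)

lemma integrable_fst_controlSource (a g l : E) :
    Integrable (fun s => U l s * (Dmvec (U a s + U g s)).1) mu01 := by
  refine MemLp.integrable one_le_two (memLp_of_continuous (C := ‖l‖) ?_ fun s => ?_)
  · have := continuous_U a
    have := continuous_U g
    have := continuous_U l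
    unfold Dmvec
    fun_prop
  · rw [abs_mul]
    refine (mul_le_of_le_one_right (abs_nonneg _) ?_).trans (abs_U_le l s)
    simpa [Dmvec] using Real.abs_sin_le_one _

lemma integrable_snd_controlSource (a g l : E) :
    Integrable (fun s => U l s * (Dmvec (U a s + U g s)).2) mu01 := by
  refine MemLp.integrable one_le_two (memLp_of_continuous (C := ‖l‖) ?_ fun s => ?_)
  · have := continuous_U a
    have := continuous_U g
    have := continuous_U l
    unfold Dmvec
    fun_prop
  · rw [abs_mul]
    exact (mul_le_of_le_one_right (abs_nonneg _) (Real.abs_cos_le_one _)).trans (abs_U_le l s)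

lemma abs_integral_le {f : ℝ → ℝ} {C : ℝ} (h : ∀ s, |f s| ≤ C) : |∫ s, f s ∂mu01| ≤ C := by
  simpa using norm_integral_le_of_norm_le_const (μ := mu01) (f := f) (.of_forall h)

lemma abs_integral_sub_le {f g : ℝ → ℝ} (hf : Integrable f mu01) (hg : Integrable g mu01) {C : ℝ}
    (h : ∀ s, |f s - g s| ≤ C) : |(∫ s, f s ∂mu01) - ∫ s, g s ∂mu01| ≤ C := by
  rw [← integral_sub hf hg]
  exact abs_integral_le h

/-! ### Weak formulations as operator equations -/

lemma eq_poissonSol_iff {f : ℝ → ℝ} (hf : MemLp f 2 mu01) (g : E) :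
    g = poissonSol f ↔ ∀ w : E, ∫ s, g s * w s ∂mu01 = ∫ s, f s * U w s ∂mu01 := by
  simp only [← inner_poissonSol hf, ← inner_eq_integral_mul]
  exact ⟨fun h w => by rw [h], fun h => ext_inner_right ℝ h⟩

lemma isStateSolF_iff (p : ℝ × ℝ) (a g : E) :
    IsStateSolF (U a) p g ↔ g = poissonSol fun s => edot p (Dmvec (U a s + U g s)) := by
  simp only [eq_poissonSol_iff (memLp_stateSource p a g), IsStateSolF, sub_eq_zero]

lemma integral_sub_mul_U {f : ℝ → ℝ} (hf : MemLp f 2 mu01) (g w : E) :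
    ∫ s, (U g s - f s) * U w s ∂mu01
      = inner ℝ (poissonSol (U g)) w - inner ℝ (poissonSol f) w := by
  rw [inner_poissonSol hf, inner_poissonSol (memLp_U g)]
  simp only [sub_mul]
  exact integral_sub ((memLp_U g).integrable_mul (memLp_U w)) (hf.integrable_mul (memLp_U w))

lemma isAdjSolF_iff {f : ℝ → ℝ} (hf : MemLp f 2 mu01) (p : ℝ × ℝ) (a g l : E) :
    IsAdjSolF (U a) p g f l ↔
      l = poissonSol (fun s => U l s * edot p (D2mvec (U a s + U g s))) + poissonSol (U g)
        - poissonSol f := by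
  simp only [IsAdjSolF, integral_sub_mul_U hf, ← inner_eq_integral_mul,
    ← inner_poissonSol (memLp_adjointSource p a g l), ← inner_sub_left]
  constructor
  · intro h
    refine ext_inner_right ℝ fun w => ?_
    rw [add_sub_assoc, inner_add_left, ← h, inner_sub_left]
    ring
  · intro h w
    conv_lhs => rw [sub_eq_of_eq_add' (h.trans (add_sub_assoc _ _ _))]

lemma design_iff {n : ℕ} {ε : ℝ} (hε : 0 < ε) (h : Fin n → ℝ × ℝ) (a : E) (th l : Fin n → E) :
    (∀ w : E, ε * (∫ s, (a : ℝ → ℝ) s * (w : ℝ → ℝ) s ∂mu01)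
      + ∑ i, (∫ s, U (l i) s * edot (h i) (D2mvec (U a s + U (th i) s)) * U w s ∂mu01) = 0) ↔
    a = -(1 / ε) • ∑ i, poissonSol fun s =>
      U (l i) s * edot (h i) (D2mvec (U a s + U (th i) s)) := by
  simp only [← inner_eq_integral_mul,
    ← fun i => inner_poissonSol (memLp_adjointSource (h i) a (th i) (l i)), ← sum_inner]
  simp only [← real_inner_smul_left, ← inner_add_left]
  rw [neg_smul, one_div, eq_neg_iff_add_eq_zero]
  constructor
  · intro H
    rw [← smul_right_inj hε.ne', smul_add, smul_inv_smul₀ hε.ne', smul_zero]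
    exact ext_inner_right ℝ fun w => by rw [H, inner_zero_left]
  · intro H w
    rw [← smul_right_inj hε.ne', smul_add, smul_inv_smul₀ hε.ne', smul_zero] at H
    rw [H, inner_zero_left]

lemma control_iff {γ : ℝ} (hγ : 0 < γ) (p : ℝ × ℝ) (a g l : E) :
    (γ * p.1 = -(∫ s, U l s * (Dmvec (U a s + U g s)).1 ∂mu01) ∧
      γ * p.2 = -(∫ s, U l s * (Dmvec (U a s + U g s)).2 ∂mu01)) ↔ p = Tval γ (U a) g l := by
  have key : ∀ x y : ℝ, γ * x = -y ↔ x = -(1 / γ) * y := fun x y => by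
    constructor
    · intro h
      field_simp
      linarith
    · rintro rfl
      field_simp
  rw [Prod.ext_iff, key, key]
  rfl

/-- The fixed-point map of the Euler–Lagrange system, with rescaled controls `h = ρ k`; `b` is the
contribution of the targets to the adjoint states. -/
noncomputable def elMap {n : ℕ} (b : Fin n → E) (ε γ ρ : ℝ)
    (x : (Fin n → ℝ × ℝ) × E × (Fin n → E) × (Fin n → E)) :
    (Fin n → ℝ × ℝ) × E × (Fin n → E) × (Fin n → E) :=
  (fun i => ρ⁻¹ • Tval γ (U x.2.1) (x.2.2.1 i) (x.2.2.2 i),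
   -(1 / ε) • ∑ i, poissonSol fun s =>
      U (x.2.2.2 i) s * edot (ρ • x.1 i) (D2mvec (U x.2.1 s + U (x.2.2.1 i) s)),
   fun i => poissonSol fun s => edot (ρ • x.1 i) (Dmvec (U x.2.1 s + U (x.2.2.1 i) s)),
   fun i => poissonSol (fun s =>
      U (x.2.2.2 i) s * edot (ρ • x.1 i) (D2mvec (U x.2.1 s + U (x.2.2.1 i) s)))
      + poissonSol (U (x.2.2.1 i)) - b i)

lemma solEQ_iff {n : ℕ} {tb : Fin n → ℝ → ℝ} (htb : ∀ i, MemLp (tb i) 2 mu01) {ε γ ρ : ℝ}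
    (hε : 0 < ε) (hγ : 0 < γ) (hρ : 0 < ρ) (k : Fin n → ℝ × ℝ) (a : E) (th l : Fin n → E) :
    SolEQ tb ε γ (ρ • k) a th l ↔
      Function.IsFixedPt (elMap (fun i => poissonSol (tb i)) ε γ ρ) (k, a, th, l) := by
  simp only [SolEQ, isStateSolF_iff, fun i => isAdjSolF_iff (htb i), design_iff hε,
    control_iff hγ, Function.IsFixedPt, elMap, Prod.mk.injEq, Pi.smul_apply]
  simp only [funext_iff, inv_smul_eq_iff₀ hρ.ne']
  constructor
  · rintro ⟨h1, h2, h3, h4⟩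
    exact ⟨fun i => (h4 i).symm, h3.symm, fun i => (h1 i).symm, fun i => (h2 i).symm⟩
  · rintro ⟨h4, h3, h1, h2⟩
    exact ⟨fun i => (h1 i).symm, fun i => (h2 i).symm, h3.symm, fun i => (h4 i).symm⟩

/-! ### Contraction and a priori bounds -/

lemma norm_Tval_sub_le {γ : ℝ} (hγ : 0 < γ) {a g l a' g' l' : E} {B D : ℝ} (hl' : ‖l'‖ ≤ B)
    (ha : ‖a - a'‖ ≤ D) (hg : ‖g - g'‖ ≤ D) (hl : ‖l - l'‖ ≤ D) :
    ‖Tval γ (U a) g l - Tval γ (U a') g' l'‖ ≤ 1 / γ * ((1 + 2 * B) * D) := by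
  have hv : ∀ s, |(U a s + U g s) - (U a' s + U g' s)| ≤ 2 * D := fun s => by
    rw [add_sub_add_comm]
    linarith [abs_add_le (U a s - U a' s) (U g s - U g' s), abs_U_sub_le a a' s,
      abs_U_sub_le g g' s]
  have hB : 0 ≤ B := (norm_nonneg _).trans hl'
  have key : ∀ s (y y' : ℝ), |y| ≤ 1 → |y - y'| ≤ 2 * D →
      |U l s * y - U l' s * y'| ≤ (1 + 2 * B) * D := fun s y y' h1 h2 => by
    have e1 := mul_le_mul ((abs_U_sub_le l l' s).trans hl) h1 (abs_nonneg _)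
      ((norm_nonneg _).trans hl)
    have e2 := mul_le_mul ((abs_U_le l' s).trans hl') h2 (abs_nonneg _) hB
    linarith [abs_mul_sub_mul_le (U l s) y (U l' s) y']
  rw [Prod.norm_def]
  simp only [Tval, Prod.fst_sub, Prod.snd_sub, ← mul_sub, norm_mul, norm_neg,
    Real.norm_of_nonneg (one_div_pos.2 hγ).le]
  refine max_le (mul_le_mul_of_nonneg_left ?_ (by positivity))
    (mul_le_mul_of_nonneg_left ?_ (by positivity))
  · refine abs_integral_sub_le (integrable_fst_controlSource _ _ _)
      (integrable_fst_controlSource _ _ _) fun s => key s _ _ ?_ ?_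
    · simpa [Dmvec] using Real.abs_sin_le_one _
    · exact (norm_fst_le _).trans ((norm_Dmvec_sub_le _ _).trans (hv s))
  · refine abs_integral_sub_le (integrable_snd_controlSource _ _ _)
      (integrable_snd_controlSource _ _ _) fun s => key s _ _ ?_ ?_
    · exact Real.abs_cos_le_one _
    · exact (norm_snd_le _).trans ((norm_Dmvec_sub_le _ _).trans (hv s))

lemma norm_stateSol_sub_le {p p' : ℝ × ℝ} {a g a' g' : E} {δ η D : ℝ} (hp' : ‖p'‖ ≤ δ)
    (hp : ‖p - p'‖ ≤ η) (ha : ‖a - a'‖ ≤ D) (hg : ‖g - g'‖ ≤ D) :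
    ‖poissonSol (fun s => edot p (Dmvec (U a s + U g s)))
      - poissonSol (fun s => edot p' (Dmvec (U a' s + U g' s)))‖
      ≤ 2 / 3 * (2 * η + 2 * δ * (2 * D)) := by
  refine norm_poissonSol_sub_le (memLp_stateSource _ _ _) (memLp_stateSource _ _ _) fun s => ?_
  refine (abs_edot_Dmvec_sub_le _ _ _ _).trans ?_
  have hδ : 0 ≤ δ := (norm_nonneg _).trans hp'
  gcongr
  rw [add_sub_add_comm]
  linarith [abs_add_le (U a s - U a' s) (U g s - U g' s), abs_U_sub_le a a' s,
    abs_U_sub_le g g' s]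

lemma norm_adjointSol_sub_le {p p' : ℝ × ℝ} {a g l a' g' l' : E} {B δ η D : ℝ} (hl' : ‖l'‖ ≤ B)
    (hp₀ : ‖p‖ ≤ δ) (hp' : ‖p'‖ ≤ δ) (hp : ‖p - p'‖ ≤ η) (ha : ‖a - a'‖ ≤ D)
    (hg : ‖g - g'‖ ≤ D) (hl : ‖l - l'‖ ≤ D) :
    ‖poissonSol (fun s => U l s * edot p (D2mvec (U a s + U g s)))
      - poissonSol (fun s => U l' s * edot p' (D2mvec (U a' s + U g' s)))‖
      ≤ 2 / 3 * (D * (2 * δ) + B * (2 * η + 2 * δ * (2 * D))) := by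
  refine norm_poissonSol_sub_le (memLp_adjointSource _ _ _ _) (memLp_adjointSource _ _ _ _)
    fun s => ?_
  have hδ : 0 ≤ δ := (norm_nonneg _).trans hp'
  have hB : 0 ≤ B := (norm_nonneg _).trans hl'
  have hD : 0 ≤ D := (norm_nonneg _).trans hl
  refine (abs_mul_sub_mul_le _ _ _ _).trans (add_le_add ?_ ?_)
  · refine mul_le_mul ((abs_U_sub_le _ _ _).trans hl) ?_ (abs_nonneg _) hD
    exact (abs_edot_D2mvec_le _ _).trans ((enorm2_le _).trans (by gcongr))
  · refine mul_le_mul ((abs_U_le _ _).trans hl') ?_ (abs_nonneg _) hB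
    refine (abs_edot_D2mvec_sub_le _ _ _ _).trans ?_
    gcongr
    rw [add_sub_add_comm]
    linarith [abs_add_le (U a s - U a' s) (U g s - U g' s), abs_U_sub_le a a' s,
      abs_U_sub_le g g' s]

lemma norm_elMap_sub_le {n : ℕ} (b : Fin n → E) {ε γ ρ B : ℝ} (hε : 0 < ε) (hγ : 0 < γ)
    (hρ : 0 < ρ) (hB : 0 ≤ B) (h1 : 12 * (ρ * ((2 + 4 * B) * (1 + B))) ≤ 1)
    (h2 : n / ε * (ρ * ((2 + 4 * B) * (1 + B))) ≤ 3 / 4) (h3 : 1 + 2 * B ≤ 3 / 4 * (γ * ρ))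
    {x y : (Fin n → ℝ × ℝ) × E × (Fin n → E) × (Fin n → E)} (hx : ‖x‖ ≤ B) (hy : ‖y‖ ≤ B) :
    ‖elMap b ε γ ρ x - elMap b ε γ ρ y‖ ≤ 3 / 4 * ‖x - y‖ := by
  obtain ⟨k, a, g, l⟩ := x
  obtain ⟨k', a', g', l'⟩ := y
  set D := ‖(k, a, g, l) - (k', a', g', l')‖ with hD
  have hD0 : 0 ≤ D := norm_nonneg _
  have hD' : ‖k - k'‖ ≤ D ∧ ‖a - a'‖ ≤ D ∧ ‖g - g'‖ ≤ D ∧ ‖l - l'‖ ≤ D := by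
    simp [hD, Prod.norm_def]
  obtain ⟨hk, ha, hg, hl⟩ := hD'
  have hx' : ‖k‖ ≤ B := (norm_fst_le (k, a, g, l)).trans hx
  have hy' : ‖k'‖ ≤ B := (norm_fst_le (k', a', g', l')).trans hy
  have hl' : ‖l'‖ ≤ B :=
    (((norm_snd_le (g', l')).trans (norm_snd_le (a', g', l'))).trans
      (norm_snd_le (k', a', g', l'))).trans hy
  have hki : ∀ i, ‖ρ • k i‖ ≤ ρ * B := fun i => by
    rw [norm_smul, Real.norm_of_nonneg hρ.le]
    gcongr
    exact (norm_le_pi_norm k i).trans hx'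
  have hki' : ∀ i, ‖ρ • k' i‖ ≤ ρ * B := fun i => by
    rw [norm_smul, Real.norm_of_nonneg hρ.le]
    gcongr
    exact (norm_le_pi_norm k' i).trans hy'
  have hkd : ∀ i, ‖ρ • k i - ρ • k' i‖ ≤ ρ * D := fun i => by
    rw [← smul_sub, norm_smul, Real.norm_of_nonneg hρ.le]
    gcongr
    exact (norm_le_pi_norm (k - k') i).trans hk
  have hgi : ∀ i, ‖g i - g' i‖ ≤ D := fun i => (norm_le_pi_norm (g - g') i).trans hg
  have hli : ∀ i, ‖l i - l' i‖ ≤ D := fun i => (norm_le_pi_norm (l - l') i).trans hl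
  have hadj : ∀ i, ‖poissonSol (fun s => U (l i) s * edot (ρ • k i) (D2mvec (U a s + U (g i) s)))
      - poissonSol (fun s => U (l' i) s * edot (ρ • k' i) (D2mvec (U a' s + U (g' i) s)))‖
      ≤ 2 / 3 * (ρ * ((2 + 4 * B) * (1 + B)) * D) := fun i => by
    refine (norm_adjointSol_sub_le ((norm_le_pi_norm l' i).trans hl') (hki i) (hki' i) (hkd i) ha
      (hgi i) (hli i)).trans ?_
    have : 0 ≤ ρ * D * (1 + B) := by positivity
    nlinarith
  rw [elMap, elMap, Prod.norm_def, Prod.norm_def, Prod.norm_def]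
  refine max_le ?_ (max_le ?_ (max_le ?_ ?_))
  · refine (pi_norm_le_iff_of_nonneg (by positivity)).2 fun i => ?_
    simp only [Prod.fst_sub, Pi.sub_apply]
    rw [← smul_sub, norm_smul, norm_inv, Real.norm_of_nonneg hρ.le]
    calc _ ≤ ρ⁻¹ * (1 / γ * ((1 + 2 * B) * D)) := by
          gcongr
          exact norm_Tval_sub_le hγ ((norm_le_pi_norm l' i).trans hl') ha (hgi i) (hli i)
      _ ≤ ρ⁻¹ * (1 / γ * ((3 / 4 * (γ * ρ)) * D)) := by gcongr
      _ = 3 / 4 * D := by field_simp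
  · simp only [Prod.fst_sub, Prod.snd_sub]
    rw [← smul_sub, ← Finset.sum_sub_distrib, norm_smul, norm_neg,
      Real.norm_of_nonneg (by positivity)]
    calc _ ≤ 1 / ε * ∑ _i : Fin n, (ρ * ((2 + 4 * B) * (1 + B)) * D) := by
          gcongr
          refine (norm_sum_le _ _).trans (Finset.sum_le_sum fun i _ => (hadj i).trans ?_)
          have : 0 ≤ ρ * ((2 + 4 * B) * (1 + B)) * D := by positivity
          linarith
      _ = n / ε * (ρ * ((2 + 4 * B) * (1 + B))) * D := by
          simp only [Finset.sum_const, Finset.card_univ, Fintype.card_fin, nsmul_eq_mul]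
          ring
      _ ≤ 3 / 4 * D := by gcongr
  · refine (pi_norm_le_iff_of_nonneg (by positivity)).2 fun i => ?_
    simp only [Prod.fst_sub, Prod.snd_sub, Pi.sub_apply]
    refine (norm_stateSol_sub_le (hki' i) (hkd i) ha (hgi i)).trans ?_
    have : 0 ≤ ρ * D * B := by positivity
    nlinarith [mul_le_mul_of_nonneg_right h1 hD0, mul_nonneg this hB, mul_nonneg hρ.le hD0]
  · refine (pi_norm_le_iff_of_nonneg (by positivity)).2 fun i => ?_
    simp only [Prod.snd_sub, Pi.sub_apply]
    rw [sub_sub_sub_cancel_right, add_sub_add_comm]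
    have hU := norm_poissonSol_sub_le (memLp_U (g i)) (memLp_U (g' i))
      fun s => (abs_U_sub_le (g i) (g' i) s).trans (hgi i)
    refine (norm_add_le _ _).trans ((add_le_add (hadj i) hU).trans ?_)
    nlinarith [mul_le_mul_of_nonneg_right h1 hD0]

lemma elMap_zero {n : ℕ} (b : Fin n → E) (ε γ ρ : ℝ) : elMap b ε γ ρ 0 = (0, 0, 0, -b) := by
  have h0 : poissonSol (fun _ => 0) = 0 := by
    have h : MemLp (fun _ : ℝ => (0 : ℝ)) 2 mu01 := MemLp.zero
    simpa using norm_poissonSol_le h (C := 0) (by simp)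
  have hU : U 0 = fun _ => 0 := funext U_zero
  ext1
  · funext i
    simp [elMap, Tval, ← Prod.zero_eq_mk]
  ext1
  · simp [elMap, h0]
  ext1
  · funext i
    simp [elMap, edot, h0]
  · funext i
    simp [elMap, hU, h0]

/-- A priori bound for adjoint states; this is where the sharp Poincaré constant enters. -/
lemma norm_adjoint_le {p : ℝ × ℝ} {K : ℝ} (hp : enorm2 p ≤ K) {a g l b : E} (hg : ‖g‖ ≤ K)
    (hl : l = poissonSol (fun s => U l s * edot p (D2mvec (U a s + U g s))) + poissonSol (U g)
      - b) :
    (1 - 4 / Real.pi ^ 2 * K) * ‖l‖ ≤ K + ‖b‖ := by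
  have hpi := Real.pi_pos
  have hK : 0 ≤ K := (norm_nonneg _).trans hg
  have h1 : ‖poissonSol (fun s => U l s * edot p (D2mvec (U a s + U g s)))‖
      ≤ 2 / Real.pi * (K * (2 / Real.pi * ‖l‖)) := by
    rw [poissonSol_of_memLp (memLp_adjointSource p a g l)]
    refine (norm_adjoint_primitiveCLM_le _).trans ?_
    gcongr
    refine (Lp.norm_le_mul_norm_of_ae_le_mul (g := (memLp_U l).toLp (U l)) ?_).trans
      (mul_le_mul_of_nonneg_left (norm_toLp_U_le l) hK)
    filter_upwards [(memLp_U l).coeFn_toLp, (memLp_adjointSource p a g l).coeFn_toLp]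
      with s e1 e2
    rw [e1, e2, norm_mul, mul_comm]
    exact mul_le_mul_of_nonneg_right ((abs_edot_D2mvec_le _ _).trans hp) (norm_nonneg _)
  have h2 : ‖poissonSol (U g)‖ ≤ K := by
    have := norm_poissonSol_le (memLp_U g) fun s => (abs_U_le g s).trans hg
    linarith
  have h3 : ‖l‖ ≤ 2 / Real.pi * (K * (2 / Real.pi * ‖l‖)) + K + ‖b‖ := by
    conv_lhs => rw [hl]
    exact (norm_sub_le _ _).trans (add_le_add_left ((norm_add_le _ _).trans (add_le_add h1 h2)) _)
  have h4 : 2 / Real.pi * (K * (2 / Real.pi * ‖l‖)) = 4 / Real.pi ^ 2 * K * ‖l‖ := by ring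
  linarith

lemma norm_state_le {p : ℝ × ℝ} {a g : E}
    (hg : g = poissonSol fun s => edot p (Dmvec (U a s + U g s))) : ‖g‖ ≤ enorm2 p := by
  have h := norm_poissonSol_le (memLp_stateSource p a g) fun s => abs_edot_Dmvec_le p _
  rw [← hg] at h
  linarith [norm_nonneg g]

lemma norm_Tval_le {γ : ℝ} (hγ : 0 < γ) (a g l : E) :
    ‖Tval γ (U a) g l‖ ≤ 1 / γ * ‖l‖ := by
  have key : ∀ s (y : ℝ), |y| ≤ 1 → |U l s * y| ≤ ‖l‖ := fun s y hy => by
    rw [abs_mul]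
    exact (mul_le_of_le_one_right (abs_nonneg _) hy).trans (abs_U_le l s)
  rw [Prod.norm_def]
  simp only [Tval, norm_mul, norm_neg, Real.norm_of_nonneg (one_div_pos.2 hγ).le]
  refine max_le (mul_le_mul_of_nonneg_left ?_ (by positivity))
    (mul_le_mul_of_nonneg_left ?_ (by positivity))
  · exact abs_integral_le fun s => key s _ (by simpa [Dmvec] using Real.abs_sin_le_one _)
  · exact abs_integral_le fun s => key s _ (Real.abs_cos_le_one _)

lemma norm_design_le {n : ℕ} {ε K M : ℝ} (hε : 0 < ε) {h : Fin n → ℝ × ℝ} {a : E}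
    {th l : Fin n → E} (hh : ∀ i, enorm2 (h i) ≤ K) (hl : ∀ i, ‖l i‖ ≤ M)
    (ha : a = -(1 / ε) • ∑ i, poissonSol fun s =>
      U (l i) s * edot (h i) (D2mvec (U a s + U (th i) s))) :
    ‖a‖ ≤ n / ε * (M * K) := by
  have key : ∀ i, ‖poissonSol fun s => U (l i) s * edot (h i) (D2mvec (U a s + U (th i) s))‖
      ≤ M * K := fun i => by
    have hM : 0 ≤ M := (norm_nonneg _).trans (hl i)
    have hK : 0 ≤ K := (Real.sqrt_nonneg _).trans (hh i)
    have := norm_poissonSol_le (memLp_adjointSource (h i) a (th i) (l i)) (C := M * K)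
      fun s => by
        rw [abs_mul]
        exact mul_le_mul ((abs_U_le _ _).trans (hl i)) ((abs_edot_D2mvec_le _ _).trans (hh i))
          (abs_nonneg _) hM
    nlinarith [mul_nonneg hM hK]
  rw [ha, norm_smul, norm_neg, Real.norm_of_nonneg (by positivity)]
  calc _ ≤ 1 / ε * ∑ _i : Fin n, M * K := by
        gcongr
        exact (norm_sum_le _ _).trans (Finset.sum_le_sum fun i _ => key i)
    _ = _ := by
        simp only [Finset.sum_const, Finset.card_univ, Fintype.card_fin, nsmul_eq_mul]
        ring

lemma memLp_of_continuousOn {f : ℝ → ℝ} (hf : ContinuousOn f (Icc 0 1)) : MemLp f 2 mu01 := by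
  obtain ⟨C, hC⟩ := isCompact_Icc.exists_bound_of_continuousOn hf
  refine MemLp.of_bound ?_ C ?_
  · exact (hf.mono Ioo_subset_Icc_self).aestronglyMeasurable measurableSet_Ioo
  · filter_upwards [ae_mem_Ioo] with s hs
    exact hC s (Ioo_subset_Icc_self hs)

lemma exists_fixedPt_and_unique {n : ℕ} (b : Fin n → E) {ε γ ρ B : ℝ} (hB : 4 * ‖b‖ ≤ B)
    (hlip : ∀ x y, ‖x‖ ≤ B → ‖y‖ ≤ B →
      ‖elMap b ε γ ρ x - elMap b ε γ ρ y‖ ≤ 3 / 4 * ‖x - y‖) :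
    ∃ x, ‖x‖ ≤ B ∧ Function.IsFixedPt (elMap b ε γ ρ) x ∧
      ∀ y, ‖y‖ ≤ B → Function.IsFixedPt (elMap b ε γ ρ) y → y = x := by
  have hB0 : 0 ≤ B := (by positivity : 0 ≤ 4 * ‖b‖).trans hB
  have hmaps : MapsTo (elMap b ε γ ρ) (Metric.closedBall 0 B) (Metric.closedBall 0 B) := by
    intro x hx
    rw [mem_closedBall_zero_iff] at hx ⊢
    have h0 : ‖elMap b ε γ ρ 0‖ = ‖b‖ := by simp [elMap_zero, Prod.norm_def]
    have h1 := hlip x 0 hx (by simpa using hB0)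
    rw [sub_zero] at h1
    linarith [norm_sub_norm_le (elMap b ε γ ρ x) (elMap b ε γ ρ 0)]
  have hcontr : ContractingWith (3 / 4) (hmaps.restrict _ _ _) := by
    refine ⟨by rw [div_lt_one (by norm_num)]; norm_num, LipschitzWith.of_dist_le_mul ?_⟩
    rintro ⟨x, hx⟩ ⟨y, hy⟩
    rw [mem_closedBall_zero_iff] at hx hy
    simpa [Subtype.dist_eq, dist_eq_norm] using hlip x y hx hy
  obtain ⟨x, hx, hfix, -⟩ := ContractingWith.exists_fixedPoint'
    Metric.isClosed_closedBall.isComplete hmaps hcontr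
    (x := 0) (by simpa using hB0) (edist_ne_top _ _)
  rw [mem_closedBall_zero_iff] at hx
  refine ⟨x, hx, hfix, fun y hy hyfix => ?_⟩
  have h := hlip y x hy hx
  rw [hfix.eq, hyfix.eq] at h
  exact sub_eq_zero.1 (norm_le_zero_iff.1 (by linarith [norm_nonneg (y - x)]))

/-- Theorem `exun`: for continuous targets, `ε > 0` and
`0 < K < π²/4`, there is `γ*` such that for all `γ > γ*` the system (EQ) has exactly one
solution with `maxᵢ|hᵢ| ≤ K`; moreover this solution satisfies `‖ϑᵢ‖_∞ ≤ |hᵢ|`. -/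
theorem EQ_exists_unique (n : ℕ)
    (tb : Fin n → ℝ → ℝ) (htb : ∀ i, ContinuousOn (tb i) (Icc (0:ℝ) 1))
    (ε : ℝ) (hε : 0 < ε) (K : ℝ) (hK0 : 0 < K) (hK : K < Real.pi ^ 2 / 4) :
    ∃ γs : ℝ, ∀ γ : ℝ, γs < γ →
      ∃ (h : Fin n → ℝ × ℝ) (a : E) (th l : Fin n → E),
        SolEQ tb ε γ h a th l ∧ (∀ i, enorm2 (h i) ≤ K) ∧
        -- uniqueness within `{maxᵢ|hᵢ| ≤ K}`:
        (∀ (h' : Fin n → ℝ × ℝ) (a' : E) (th' l' : Fin n → E),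
          SolEQ tb ε γ h' a' th' l' → (∀ i, enorm2 (h' i) ≤ K) →
          h' = h ∧ a' = a ∧ th' = th ∧ l' = l) ∧
        -- the bound `‖ϑᵢ‖_∞ ≤ |hᵢ|`:
        (∀ i, ∀ t ∈ Icc (0:ℝ) 1, |U (th i) t| ≤ enorm2 (h i)) := by
  have hpi := Real.pi_pos
  have htb' : ∀ i, MemLp (tb i) 2 mu01 := fun i => memLp_of_continuousOn (htb i)
  set b : Fin n → E := fun i => poissonSol (tb i) with hb
  have hcoer : 0 < 1 - 4 / Real.pi ^ 2 * K := by
    rw [sub_pos, div_mul_eq_mul_div, div_lt_one (by positivity)]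
    linarith
  set M := (K + ‖b‖) / (1 - 4 / Real.pi ^ 2 * K) with hM
  have hM0 : 0 ≤ M := by positivity
  set B := 4 * ‖b‖ + K + M + n / ε * (M * K) with hBdef
  have ht : 0 ≤ n / ε * (M * K) := by positivity
  have hb0 := norm_nonneg b
  have hB0 : 0 ≤ B := by positivity
  set Q := 12 * ((2 + 4 * B) * (1 + B)) + 2 * (n / ε * ((2 + 4 * B) * (1 + B))) + 2 * B / K
    with hQ
  have hQ0 : 0 < Q := by positivity
  have hsmall : ∀ q, q ≤ Q → Q⁻¹ * q ≤ 1 := fun q hq => by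
    rw [inv_mul_le_iff₀ hQ0]
    linarith
  set ρ := Q⁻¹ with hρdef
  have hρ : 0 < ρ := inv_pos.2 hQ0
  have hA1 : 12 * (ρ * ((2 + 4 * B) * (1 + B))) ≤ 1 := by
    have := hsmall (12 * ((2 + 4 * B) * (1 + B))) (by
      have : 0 ≤ 2 * (n / ε * ((2 + 4 * B) * (1 + B))) + 2 * B / K := by positivity
      linarith)
    linarith
  have hA2 : n / ε * (ρ * ((2 + 4 * B) * (1 + B))) ≤ 3 / 4 := by
    have := hsmall (2 * (n / ε * ((2 + 4 * B) * (1 + B)))) (by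
      have : 0 ≤ 12 * ((2 + 4 * B) * (1 + B)) + 2 * B / K := by positivity
      linarith)
    linarith
  have hA3 : ρ * (2 * B) ≤ K := by
    have := hsmall (2 * B / K) (by
      have : 0 ≤ 12 * ((2 + 4 * B) * (1 + B)) + 2 * (n / ε * ((2 + 4 * B) * (1 + B))) := by
        positivity
      linarith)
    rwa [← mul_div_assoc, div_le_one hK0] at this
  refine ⟨2 * (1 + 2 * B) / ρ, fun γ hγs => ?_⟩
  have hγ : 0 < γ := lt_of_le_of_lt (by positivity) hγs
  have hγρ : 2 * (1 + 2 * B) < γ * ρ := (div_lt_iff₀ hρ).1 hγs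
  obtain ⟨⟨k, a, th, l⟩, hx, hfix, huniq⟩ := exists_fixedPt_and_unique b (ε := ε) (γ := γ) (ρ := ρ)
    (B := B) (by linarith) fun x y hx hy =>
      norm_elMap_sub_le b hε hγ hρ hB0 hA1 hA2 (by linarith) hx hy
  have hsol := (solEQ_iff htb' hε hγ hρ k a th l).2 hfix
  refine ⟨ρ • k, a, th, l, hsol, fun i => ?_, fun h' a' th' l' hsol' hK' => ?_, fun i t _ => ?_⟩
  · refine (enorm2_le _).trans ?_
    rw [Pi.smul_apply, norm_smul, Real.norm_of_nonneg hρ.le]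
    have hki : ‖k i‖ ≤ B :=
      (norm_le_pi_norm k i).trans ((norm_fst_le (k, a, th, l)).trans hx)
    linarith [mul_le_mul_of_nonneg_left hki hρ.le]
  · have hh' : h' = ρ • (ρ⁻¹ • h') := (smul_inv_smul₀ hρ.ne' h').symm
    have hfix' : Function.IsFixedPt (elMap b ε γ ρ) (ρ⁻¹ • h', a', th', l') := by
      rw [hh'] at hsol'
      exact (solEQ_iff htb' hε hγ hρ _ a' th' l').1 hsol'
    obtain ⟨hst, hadj, hdes, hctl⟩ := hsol'
    have hth' : ∀ i, ‖th' i‖ ≤ K := fun i =>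
      (norm_state_le ((isStateSolF_iff _ _ _).1 (hst i))).trans (hK' i)
    have hl' : ∀ i, ‖l' i‖ ≤ M := fun i => by
      rw [hM, le_div_iff₀' hcoer]
      refine (norm_adjoint_le (hK' i) (hth' i)
        ((isAdjSolF_iff (htb' i) _ _ _ _).1 (hadj i))).trans ?_
      gcongr
      exact norm_le_pi_norm b i
    have ha' : ‖a'‖ ≤ n / ε * (M * K) :=
      norm_design_le hε hK' hl' ((design_iff hε h' a' th' l').1 hdes)
    have hk' : ∀ i, ‖(ρ⁻¹ • h') i‖ ≤ B := fun i => by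
      rw [Pi.smul_apply, norm_smul, norm_inv, Real.norm_of_nonneg hρ.le,
        (control_iff hγ _ _ _ _).1 (hctl i), inv_mul_le_iff₀ hρ]
      refine (norm_Tval_le hγ _ _ _).trans ?_
      rw [one_div, inv_mul_le_iff₀ hγ]
      nlinarith [hl' i]
    have hnorm : ‖(ρ⁻¹ • h', a', th', l')‖ ≤ B := by
      simp only [Prod.norm_def]
      refine max_le ((pi_norm_le_iff_of_nonneg hB0).2 hk') (max_le (by linarith) (max_le ?_ ?_))
      · exact (pi_norm_le_iff_of_nonneg hB0).2 fun i => (hth' i).trans (by linarith)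
      · exact (pi_norm_le_iff_of_nonneg hB0).2 fun i => (hl' i).trans (by linarith)
    have heq := huniq _ hnorm hfix'
    simp only [Prod.mk.injEq] at heq
    obtain ⟨e1, e2, e3, e4⟩ := heq
    exact ⟨by rw [hh', e1], e2, e3, e4⟩
  · exact (abs_U_le _ _).trans (norm_state_le ((isStateSolF_iff _ _ _).1 (hsol.1 i)))
end

section
/- Let ϑ̄ ∈ C([0,1])ⁿ, ε > 0, and let K > 0 satisfy K < c_p^{-2} = π²/4. Then there exists γ** = γ**(ϑ̄, ε, K) such that for every γ > γ** the minimizer of C in 𝓐 is unique. Furthermore, this unique minimizer coincides (with its Lagrange multiplier) with the unique solution of the Euler–Lagrange system (EQ) in the set {max_i|h_i| ≤ K}; it is smooth, satisfies α'(0)=0, and ‖ϑ_i‖_∞ ≤ |h_i| for all i. One may take γ** = max{Θ̄²/K², γ*(ϑ̄,ε,K)}, where Θ̄² = Σ_{i=1}^n ∫₀¹ ϑ̄_i². -/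
open MeasureTheory Set

/-- The admissible space `𝓗 = ℝ^{2n} × H^1_{0L}(I) × H^1_{0L}(I)ⁿ`. -/
noncomputable abbrev Hn (n : ℕ) := (Fin n → ℝ × ℝ) × E × (Fin n → E)

/-- The admissible set `𝓐`. -/
def Admissible {n : ℕ} (x : Hn n) : Prop := ∀ i, IsStateSolF (U x.2.1) (x.1 i) (x.2.2 i)

/-- The cost functional `C = C_{ε,γ}`. -/
noncomputable def cost {n : ℕ} (tb : Fin n → ℝ → ℝ) (ε γ : ℝ) (x : Hn n) : ℝ :=
  (1 / 2) * ∑ i, (∫ s, (U (x.2.2 i) s - tb i s) ^ 2 ∂mu01)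
    + (ε / 2) * (∫ s, ((x.2.1 : ℝ → ℝ) s) ^ 2 ∂mu01)
    + (γ / 2) * ∑ i, (enorm2 (x.1 i)) ^ 2

namespace RodControl

open scoped ENNReal Topology
open Filter

instance : IsProbabilityMeasure mu01 := ⟨by simp [mu01]⟩

instance : NullSingletonClass mu01 := by unfold mu01; infer_instance

instance : IsSeparable mu01 := by unfold mu01; infer_instance

theorem ae_mem_Ioo : ∀ᵐ s ∂mu01, s ∈ Ioo (0 : ℝ) 1 :=
  ae_restrict_mem measurableSet_Ioo

theorem integrable_of_continuous {f : ℝ → ℝ} (hf : Continuous f) : Integrable f mu01 :=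
  (hf.integrableOn_Icc (a := 0) (b := 1)).mono_set Ioo_subset_Icc_self

theorem integrable_coe (g : E) : Integrable (g : ℝ → ℝ) mu01 :=
  (Lp.memLp g).integrable one_le_two

theorem integral_mul_eq_inner (g w : E) :
    ∫ s, (g : ℝ → ℝ) s * (w : ℝ → ℝ) s ∂mu01 = inner ℝ g w := by
  rw [L2.inner_def]
  refine integral_congr_ae (Eventually.of_forall fun s => ?_)
  simp [mul_comm]

theorem integral_sq_eq_norm_sq (g : E) : ∫ s, ((g : ℝ → ℝ) s) ^ 2 ∂mu01 = ‖g‖ ^ 2 := by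
  rw [← real_inner_self_eq_norm_sq, ← integral_mul_eq_inner]
  simp_rw [sq]

/-- The representer of the evaluation functional `g ↦ U g t`. -/
noncomputable def evalVec (t : ℝ) : E :=
  indicatorConstLp 2 (measurableSet_Ioc (a := 0) (b := t)) (measure_ne_top mu01 _) (1 : ℝ)

theorem U_eq_inner (g : E) (t : ℝ) : U g t = inner ℝ (evalVec t) g :=
  (L2.inner_indicatorConstLp_one (𝕜 := ℝ) measurableSet_Ioc (measure_ne_top mu01 _) g).symm

theorem norm_evalVec_le (t : ℝ) : ‖evalVec t‖ ≤ 1 := by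
  refine norm_indicatorConstLp_le.trans ?_
  rw [norm_one, one_mul]
  exact Real.rpow_le_one measureReal_nonneg measureReal_le_one (by positivity)

theorem U_add (f g : E) (t : ℝ) : U (f + g) t = U f t + U g t := by
  simp only [U_eq_inner, inner_add_right]

theorem U_sub (f g : E) (t : ℝ) : U (f - g) t = U f t - U g t := by
  simp only [U_eq_inner, inner_sub_right]

theorem U_smul (c : ℝ) (g : E) (t : ℝ) : U (c • g) t = c * U g t := by
  simp only [U_eq_inner, real_inner_smul_right]

@[simp] theorem U_zero (t : ℝ) : U 0 t = 0 := by
  simp only [U_eq_inner, inner_zero_right]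

theorem abs_U_le (g : E) (t : ℝ) : |U g t| ≤ ‖g‖ := by
  rw [U_eq_inner]
  refine (abs_real_inner_le_norm _ _).trans ?_
  exact mul_le_of_le_one_left (norm_nonneg _) (norm_evalVec_le t)

@[fun_prop] theorem continuous_U (g : E) : Continuous (U g) := by
  have h : U g = fun t => ∫ s in (0 : ℝ)..(max t 0), (g : ℝ → ℝ) s ∂mu01 := by
    funext t
    rw [intervalIntegral.integral_of_le (le_max_right t 0)]
    rcases le_total t 0 with ht | ht
    · simp [U, ht]
    · simp [U, ht]
  rw [h]
  exact ((integrable_coe g).continuous_primitive 0).comp (continuous_id.max continuous_const)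

theorem U_eq_setIntegral (g : E) {t : ℝ} (ht : t < 1) :
    U g t = ∫ s in Ioc 0 t, (g : ℝ → ℝ) s := by
  unfold U mu01
  rw [Measure.restrict_restrict measurableSet_Ioc, inter_eq_left.2]
  exact fun s hs => ⟨hs.1, hs.2.trans_lt ht⟩

theorem intervalIntegral_cos (t : ℝ) :
    ∫ s in (0 : ℝ)..t, Real.cos (Real.pi / 2 * s) = Real.sin (Real.pi / 2 * t) / (Real.pi / 2) := by
  have hk : Real.pi / 2 ≠ 0 := by positivity
  rw [intervalIntegral.integral_comp_mul_left (fun x => Real.cos x) hk]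
  simp [div_eq_inv_mul]

theorem intervalIntegral_sin (s : ℝ) :
    ∫ t in s..1, Real.sin (Real.pi / 2 * t) = Real.cos (Real.pi / 2 * s) / (Real.pi / 2) := by
  have hk : Real.pi / 2 ≠ 0 := by positivity
  rw [intervalIntegral.integral_comp_mul_left (fun x => Real.sin x) hk]
  rw [integral_sin, mul_one, Real.cos_pi_div_two, sub_zero, smul_eq_mul]
  ring

theorem cos_pos_of_mem {s : ℝ} (hs : s ∈ Ico (0 : ℝ) 1) : 0 < Real.cos (Real.pi / 2 * s) := by
  have := Real.pi_pos
  exact Real.cos_pos_of_mem_Ioo ⟨by nlinarith [hs.1], by nlinarith [hs.2]⟩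

theorem sin_pos_of_mem {s : ℝ} (hs : s ∈ Ioc (0 : ℝ) 1) : 0 < Real.sin (Real.pi / 2 * s) := by
  have := Real.pi_pos
  exact Real.sin_pos_of_pos_of_lt_pi (by nlinarith [hs.1]) (by nlinarith [hs.2])

theorem integrableOn_sq_div_cos (g : E) {t : ℝ} (ht : t < 1) :
    IntegrableOn (fun s => (g : ℝ → ℝ) s ^ 2 / Real.cos (Real.pi / 2 * s)) (Ioc 0 t) := by
  have h1 : IntegrableOn (fun s => (g : ℝ → ℝ) s ^ 2) (Ioc 0 t) := by
    have h0 : IntegrableOn (fun s => (g : ℝ → ℝ) s ^ 2) (Ioo 0 1) := (Lp.memLp g).integrable_sq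
    exact h0.mono_set fun s hs => ⟨hs.1, hs.2.trans_lt ht⟩
  simp_rw [div_eq_mul_inv]
  refine IntegrableOn.mul_continuousOn_of_subset (K := Icc 0 t) h1 ?_ measurableSet_Ioc
    isCompact_Icc Ioc_subset_Icc_self
  refine ContinuousOn.inv₀ (by fun_prop) fun s hs => (cos_pos_of_mem ⟨hs.1, ?_⟩).ne'
  exact hs.2.trans_lt ht

theorem sq_U_le (g : E) {t : ℝ} (ht : t ∈ Ioo (0 : ℝ) 1) :
    U g t ^ 2 ≤ Real.sin (Real.pi / 2 * t) / (Real.pi / 2) *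
      ∫ s in Ioc 0 t, (g : ℝ → ℝ) s ^ 2 / Real.cos (Real.pi / 2 * s) := by
  set B := Real.sin (Real.pi / 2 * t) / (Real.pi / 2) with hB
  set A := ∫ s in Ioc 0 t, (g : ℝ → ℝ) s ^ 2 / Real.cos (Real.pi / 2 * s) with hA
  have hBpos : 0 < B := div_pos (sin_pos_of_mem ⟨ht.1, ht.2.le⟩) (by positivity)
  have hBi : ∫ s in Ioc 0 t, Real.cos (Real.pi / 2 * s) = B := by
    rw [← intervalIntegral.integral_of_le ht.1.le, intervalIntegral_cos]
  have hg : IntegrableOn (fun s => (g : ℝ → ℝ) s) (Ioc 0 t) := by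
    have h0 : IntegrableOn (fun s => (g : ℝ → ℝ) s) (Ioo 0 1) := integrable_coe g
    exact h0.mono_set fun s hs => ⟨hs.1, hs.2.trans_lt ht.2⟩
  have hc : IntegrableOn (fun s => Real.cos (Real.pi / 2 * s)) (Ioc 0 t) :=
    (Continuous.integrableOn_Icc (by fun_prop)).mono_set Ioc_subset_Icc_self
  have hsq := integrableOn_sq_div_cos g ht.2
  set r := U g t / B with hr
  have key : 0 ≤ ∫ s in Ioc 0 t, ((g : ℝ → ℝ) s ^ 2 / Real.cos (Real.pi / 2 * s)
      - 2 * r * (g : ℝ → ℝ) s + r ^ 2 * Real.cos (Real.pi / 2 * s)) := by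
    refine setIntegral_nonneg measurableSet_Ioc fun s hs => ?_
    have hcs : 0 < Real.cos (Real.pi / 2 * s) :=
      cos_pos_of_mem ⟨hs.1.le, hs.2.trans_lt ht.2⟩
    have : (g : ℝ → ℝ) s ^ 2 / Real.cos (Real.pi / 2 * s)
      - 2 * r * (g : ℝ → ℝ) s + r ^ 2 * Real.cos (Real.pi / 2 * s) =
      ((g : ℝ → ℝ) s - r * Real.cos (Real.pi / 2 * s)) ^ 2 / Real.cos (Real.pi / 2 * s) := by
      generalize Real.cos (Real.pi / 2 * s) = c at hcs
      field_simp
      ring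
    rw [this]
    positivity
  have hsub : IntegrableOn (fun s => (g : ℝ → ℝ) s ^ 2 / Real.cos (Real.pi / 2 * s)
      - 2 * r * (g : ℝ → ℝ) s) (Ioc 0 t) := hsq.sub (hg.const_mul _)
  rw [integral_add hsub (hc.const_mul _),
    integral_sub hsq (hg.const_mul _), integral_const_mul, integral_const_mul, hBi, ← hA,
    ← U_eq_setIntegral g ht.2] at key
  have hrB : r * B = U g t := by rw [hr]; field_simp
  nlinarith [hrB, hBpos]

/-- The Poincaré inequality with the sharp constant. -/
theorem poincare (g : E) : ∫ s, U g s ^ 2 ∂mu01 ≤ 4 / Real.pi ^ 2 * ‖g‖ ^ 2 := by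
  set k := Real.pi / 2 with hk
  have hkpos : 0 < k := by positivity
  have hgm : Measurable fun s => (g : ℝ → ℝ) s :=
    (Lp.stronglyMeasurable g).measurable
  set φ : ℝ → ℝ≥0∞ := fun s => ENNReal.ofReal ((g : ℝ → ℝ) s ^ 2 / Real.cos (k * s)) with hφ
  set ψ : ℝ → ℝ≥0∞ := fun t => ENNReal.ofReal (Real.sin (k * t) / k) with hψ
  have hφm : Measurable φ := by fun_prop
  have hψm : Measurable ψ := by fun_prop
  have h1 : ∫⁻ t, ENNReal.ofReal (U g t ^ 2) ∂mu01 ≤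
      ∫⁻ t in Ioo 0 1, ∫⁻ s in Ioo 0 1, (Ici s).indicator ψ t * φ s := by
    refine setLIntegral_mono' measurableSet_Ioo fun t ht => ?_
    have e1 : ∫⁻ s in Ioo 0 1, (Ici s).indicator ψ t * φ s = ψ t * ∫⁻ s in Ioc 0 t, φ s := by
      rw [← lintegral_const_mul _ hφm, ← lintegral_indicator measurableSet_Ioo,
        ← lintegral_indicator measurableSet_Ioc]
      refine lintegral_congr fun s => ?_
      by_cases h0 : 0 < s
      · by_cases hst : s ≤ t
        · simp [indicator, h0, hst, hst.trans_lt ht.2]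
        · simp [indicator, h0, hst]
      · simp [indicator, h0]
    rw [e1, hψ, hφ]
    have hnn : 0 ≤ᵐ[volume.restrict (Ioc 0 t)]
        fun s => (g : ℝ → ℝ) s ^ 2 / Real.cos (k * s) := by
      filter_upwards [ae_restrict_mem measurableSet_Ioc] with s hs
      exact div_nonneg (sq_nonneg _) (cos_pos_of_mem ⟨hs.1.le, hs.2.trans_lt ht.2⟩).le
    rw [← ofReal_integral_eq_lintegral_ofReal (integrableOn_sq_div_cos g ht.2) hnn,
      ← ENNReal.ofReal_mul (div_nonneg (sin_pos_of_mem ⟨ht.1, ht.2.le⟩).le hkpos.le)]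
    exact ENNReal.ofReal_le_ofReal (sq_U_le g ht)
  have h2 : ∫⁻ t in Ioo 0 1, ∫⁻ s in Ioo 0 1, (Ici s).indicator ψ t * φ s =
      ∫⁻ s in Ioo 0 1, ∫⁻ t in Ioo 0 1, (Ici s).indicator ψ t * φ s := by
    refine lintegral_lintegral_swap (Measurable.aemeasurable ?_)
    have : (Function.uncurry fun t s => (Ici s).indicator ψ t * φ s) =
        fun p : ℝ × ℝ => {q : ℝ × ℝ | q.2 ≤ q.1}.indicator (fun q => ψ q.1) p * φ p.2 := by
      funext p
      simp [indicator, Function.uncurry]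
    rw [this]
    exact ((hψm.comp measurable_fst).indicator (measurableSet_le measurable_snd measurable_fst)).mul
      (hφm.comp measurable_snd)
  have h3 : ∫⁻ s in Ioo 0 1, ∫⁻ t in Ioo 0 1, (Ici s).indicator ψ t * φ s =
      ∫⁻ s in Ioo 0 1, ENNReal.ofReal ((g : ℝ → ℝ) s ^ 2 / k ^ 2) := by
    refine setLIntegral_congr_fun measurableSet_Ioo fun s hs => ?_
    have hcs := cos_pos_of_mem ⟨hs.1.le, hs.2⟩
    have hci : IntegrableOn (fun t => Real.sin (k * t) / k) (Ioc s 1) :=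
      (Continuous.integrableOn_Icc (by fun_prop)).mono_set Ioc_subset_Icc_self
    have hnn : 0 ≤ᵐ[volume.restrict (Ioc s 1)] fun t => Real.sin (k * t) / k := by
      filter_upwards [ae_restrict_mem measurableSet_Ioc] with t ht
      exact div_nonneg (sin_pos_of_mem ⟨hs.1.trans ht.1, ht.2⟩).le hkpos.le
    have e1 : ∫⁻ t in Ioo 0 1, (Ici s).indicator ψ t = ∫⁻ t in Ioc s 1, ψ t := by
      rw [← restrict_Ico_eq_restrict_Ioc, setLIntegral_indicator measurableSet_Ici]
      congr 2
      ext t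
      simp only [mem_inter_iff, mem_Ici, mem_Ioo, mem_Ico]
      exact ⟨fun h => ⟨h.1, h.2.2⟩, fun h => ⟨h.1, hs.1.trans_le h.1, h.2⟩⟩
    rw [lintegral_mul_const _ (hψm.indicator measurableSet_Ici), e1, hψ,
      ← ofReal_integral_eq_lintegral_ofReal hci hnn,
      ← ENNReal.ofReal_mul (integral_nonneg_of_ae hnn), integral_div,
      ← intervalIntegral.integral_of_le hs.2.le, intervalIntegral_sin]
    congr 1
    rw [← hk] at hcs ⊢
    generalize Real.cos (k * s) = c at hcs
    field_simp
  have hUi : Integrable (fun t => U g t ^ 2) mu01 := integrable_of_continuous (by fun_prop)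
  have hgi : Integrable (fun s => (g : ℝ → ℝ) s ^ 2 / k ^ 2) mu01 :=
    (Lp.memLp g).integrable_sq.div_const _
  have h4 : ENNReal.ofReal (∫ t, U g t ^ 2 ∂mu01) ≤
      ENNReal.ofReal (∫ s, (g : ℝ → ℝ) s ^ 2 / k ^ 2 ∂mu01) := by
    rw [ofReal_integral_eq_lintegral_ofReal hUi (Eventually.of_forall fun _ => sq_nonneg _),
      ofReal_integral_eq_lintegral_ofReal hgi
        (Eventually.of_forall fun _ => div_nonneg (sq_nonneg _) (sq_nonneg _))]
    exact h1.trans (h2.trans h3).le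
  rw [ENNReal.ofReal_le_ofReal_iff
      (integral_nonneg fun _ => div_nonneg (sq_nonneg _) (sq_nonneg _)),
    integral_div, integral_sq_eq_norm_sq] at h4
  refine h4.trans_eq ?_
  rw [hk]
  field_simp
  norm_num

theorem integral_abs_mul_abs_le (f g : E) :
    ∫ s, |U f s| * |U g s| ∂mu01 ≤ 4 / Real.pi ^ 2 * ‖f‖ * ‖g‖ := by
  rcases (norm_nonneg f).eq_or_lt with hf | hf
  · rw [norm_eq_zero.1 hf.symm]; simp
  rcases (norm_nonneg g).eq_or_lt with hg | hg
  · rw [norm_eq_zero.1 hg.symm]; simp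
  have h : ∫ s, |U f s| * |U g s| ∂mu01 ≤
      ∫ s, (‖g‖ / (2 * ‖f‖) * U f s ^ 2 + ‖f‖ / (2 * ‖g‖) * U g s ^ 2) ∂mu01 := by
    refine integral_mono (integrable_of_continuous (by fun_prop))
      (integrable_of_continuous (by fun_prop)) fun s => ?_
    have : ‖g‖ / (2 * ‖f‖) * U f s ^ 2 + ‖f‖ / (2 * ‖g‖) * U g s ^ 2 - |U f s| * |U g s| =
        (‖g‖ * |U f s| - ‖f‖ * |U g s|) ^ 2 / (2 * ‖f‖ * ‖g‖) := by
      rw [← sq_abs (U f s), ← sq_abs (U g s)]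
      field_simp
      ring
    have h0 : 0 ≤ (‖g‖ * |U f s| - ‖f‖ * |U g s|) ^ 2 / (2 * ‖f‖ * ‖g‖) := by positivity
    show |U f s| * |U g s| ≤ ‖g‖ / (2 * ‖f‖) * U f s ^ 2 + ‖f‖ / (2 * ‖g‖) * U g s ^ 2
    linarith
  rw [integral_add (integrable_of_continuous (by fun_prop))
      (integrable_of_continuous (by fun_prop)),
    integral_const_mul, integral_const_mul] at h
  have h1 := mul_le_mul_of_nonneg_left (poincare f) (by positivity : 0 ≤ ‖g‖ / (2 * ‖f‖))
  have h2 := mul_le_mul_of_nonneg_left (poincare g) (by positivity : 0 ≤ ‖f‖ / (2 * ‖g‖))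
  have e : ‖g‖ / (2 * ‖f‖) * (4 / Real.pi ^ 2 * ‖f‖ ^ 2) +
      ‖f‖ / (2 * ‖g‖) * (4 / Real.pi ^ 2 * ‖g‖ ^ 2) = 4 / Real.pi ^ 2 * ‖f‖ * ‖g‖ := by
    field_simp
    ring
  linarith

theorem enorm2_nonneg (p : ℝ × ℝ) : 0 ≤ enorm2 p := Real.sqrt_nonneg _

theorem sq_enorm2 (p : ℝ × ℝ) : enorm2 p ^ 2 = p.1 ^ 2 + p.2 ^ 2 :=
  Real.sq_sqrt (by positivity)

theorem abs_edot_le (p q : ℝ × ℝ) : |edot p q| ≤ enorm2 p * enorm2 q := by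
  refine abs_le_of_sq_le_sq ?_ (mul_nonneg (enorm2_nonneg _) (enorm2_nonneg _))
  rw [mul_pow, sq_enorm2, sq_enorm2, edot]
  nlinarith [sq_nonneg (p.1 * q.2 - p.2 * q.1)]

theorem abs_fst_le_enorm2 (p : ℝ × ℝ) : |p.1| ≤ enorm2 p := by
  refine abs_le_of_sq_le_sq ?_ (enorm2_nonneg _)
  rw [sq_enorm2]; nlinarith [sq_nonneg p.2]

theorem abs_snd_le_enorm2 (p : ℝ × ℝ) : |p.2| ≤ enorm2 p := by
  refine abs_le_of_sq_le_sq ?_ (enorm2_nonneg _)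
  rw [sq_enorm2]; nlinarith [sq_nonneg p.1]

theorem enorm2_le_abs_add_abs (p : ℝ × ℝ) : enorm2 p ≤ |p.1| + |p.2| := by
  refine le_of_sq_le_sq ?_ (by positivity)
  rw [sq_enorm2, ← sq_abs p.1, ← sq_abs p.2]
  nlinarith [mul_nonneg (abs_nonneg p.1) (abs_nonneg p.2)]

theorem enorm2_smul (c : ℝ) (p : ℝ × ℝ) : enorm2 (c • p) = |c| * enorm2 p := by
  rw [enorm2, enorm2, ← Real.sqrt_sq_eq_abs, ← Real.sqrt_mul (sq_nonneg c)]
  congr 1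
  simp only [Prod.smul_fst, Prod.smul_snd, smul_eq_mul]
  ring

@[simp] theorem enorm2_Dmvec (v : ℝ) : enorm2 (Dmvec v) = 1 := by
  simp [enorm2, Dmvec]

@[simp] theorem enorm2_D2mvec (v : ℝ) : enorm2 (D2mvec v) = 1 := by
  simp [enorm2, D2mvec]

theorem enorm2_Dmvec_sub_le (u v : ℝ) : enorm2 (Dmvec u - Dmvec v) ≤ |u - v| := by
  refine le_of_sq_le_sq ?_ (abs_nonneg _)
  rw [sq_enorm2, sq_abs]
  simp only [Dmvec, Prod.fst_sub, Prod.snd_sub]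
  have h := Real.one_sub_sq_div_two_le_cos (x := u - v)
  rw [Real.cos_sub] at h
  nlinarith [Real.sin_sq_add_cos_sq u, Real.sin_sq_add_cos_sq v]

theorem enorm2_D2mvec_sub_le (u v : ℝ) : enorm2 (D2mvec u - D2mvec v) ≤ |u - v| := by
  refine le_of_sq_le_sq ?_ (abs_nonneg _)
  rw [sq_enorm2, sq_abs]
  simp only [D2mvec, Prod.fst_sub, Prod.snd_sub]
  have h := Real.one_sub_sq_div_two_le_cos (x := u - v)
  rw [Real.cos_sub] at h
  nlinarith [Real.sin_sq_add_cos_sq u, Real.sin_sq_add_cos_sq v]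

theorem abs_edot_Dmvec_le (p : ℝ × ℝ) (v : ℝ) : |edot p (Dmvec v)| ≤ enorm2 p := by
  simpa using abs_edot_le p (Dmvec v)

theorem abs_edot_D2mvec_le (p : ℝ × ℝ) (v : ℝ) : |edot p (D2mvec v)| ≤ enorm2 p := by
  simpa using abs_edot_le p (D2mvec v)

theorem edot_sub_right (p q r : ℝ × ℝ) : edot p (q - r) = edot p q - edot p r := by
  simp only [edot, Prod.fst_sub, Prod.snd_sub]; ring

theorem edot_sub_left (p q r : ℝ × ℝ) : edot (p - q) r = edot p r - edot q r := by
  simp only [edot, Prod.fst_sub, Prod.snd_sub]; ring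

theorem edot_add_left (p q r : ℝ × ℝ) : edot (p + q) r = edot p r + edot q r := by
  simp only [edot, Prod.fst_add, Prod.snd_add]; ring

theorem edot_smul_left (c : ℝ) (p r : ℝ × ℝ) : edot (c • p) r = c * edot p r := by
  simp only [edot, Prod.smul_fst, Prod.smul_snd, smul_eq_mul]; ring

theorem abs_edot_Dmvec_sub_le (p : ℝ × ℝ) (u v : ℝ) :
    |edot p (Dmvec u) - edot p (Dmvec v)| ≤ enorm2 p * |u - v| := by
  rw [← edot_sub_right]
  exact (abs_edot_le _ _).trans
    (mul_le_mul_of_nonneg_left (enorm2_Dmvec_sub_le u v) (enorm2_nonneg p))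

theorem abs_edot_D2mvec_sub_le (p : ℝ × ℝ) (u v : ℝ) :
    |edot p (D2mvec u) - edot p (D2mvec v)| ≤ enorm2 p * |u - v| := by
  rw [← edot_sub_right]
  exact (abs_edot_le _ _).trans
    (mul_le_mul_of_nonneg_left (enorm2_D2mvec_sub_le u v) (enorm2_nonneg p))

theorem hasDerivAt_edot_Dmvec (p : ℝ × ℝ) (v : ℝ) :
    HasDerivAt (fun x => edot p (Dmvec x)) (edot p (D2mvec v)) v := by
  unfold edot Dmvec D2mvec
  exact ((Real.hasDerivAt_sin v).neg.const_mul p.1).add ((Real.hasDerivAt_cos v).const_mul p.2)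

theorem abs_edot_Dmvec_taylor_le (p : ℝ × ℝ) (u d : ℝ) :
    |edot p (Dmvec (u + d)) - edot p (Dmvec u) - edot p (D2mvec u) * d| ≤ enorm2 p * d ^ 2 := by
  have h := Convex.norm_image_sub_le_of_norm_hasDerivWithin_le
    (f := fun x => edot p (Dmvec x) - edot p (D2mvec u) * x)
    (f' := fun x => edot p (D2mvec x) - edot p (D2mvec u)) (s := uIcc u (u + d))
    (C := enorm2 p * |d|) (x := u) (y := u + d)
    (fun x _ => ((hasDerivAt_edot_Dmvec p x).sub
      (by simpa using (hasDerivAt_id x).const_mul (edot p (D2mvec u)))).hasDerivWithinAt)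
    (fun x hx => by
      rw [Real.norm_eq_abs]
      refine (abs_edot_D2mvec_sub_le p x u).trans
        (mul_le_mul_of_nonneg_left ?_ (enorm2_nonneg p))
      simpa using abs_sub_left_of_mem_uIcc hx)
    (convex_uIcc _ _) left_mem_uIcc right_mem_uIcc
  rw [Real.norm_eq_abs, Real.norm_eq_abs, add_sub_cancel_left, mul_assoc, abs_mul_abs_self] at h
  convert h using 2 <;> ring

@[fun_prop] theorem continuous_edot_Dmvec {X : Type*} [TopologicalSpace X] (p : ℝ × ℝ)
    {f : X → ℝ} (hf : Continuous f) :
    Continuous fun s => edot p (Dmvec (f s)) := by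
  unfold edot Dmvec; fun_prop

@[fun_prop] theorem continuous_edot_D2mvec {X : Type*} [TopologicalSpace X] (p : ℝ × ℝ)
    {f : X → ℝ} (hf : Continuous f) :
    Continuous fun s => edot p (D2mvec (f s)) := by
  unfold edot D2mvec; fun_prop

@[fun_prop] theorem continuous_Dmvec_fst {f : ℝ → ℝ} (hf : Continuous f) :
    Continuous fun s => (Dmvec (f s)).1 := by
  unfold Dmvec; fun_prop

@[fun_prop] theorem continuous_Dmvec_snd {f : ℝ → ℝ} (hf : Continuous f) :
    Continuous fun s => (Dmvec (f s)).2 := by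
  unfold Dmvec; fun_prop

/-- `g` is the derivative of the weak solution with right-hand side `F` that vanishes at the left
end and is free at the right end. -/
def IsWeak (g : E) (F : ℝ → ℝ) : Prop :=
  ∀ w : E, inner ℝ g w = ∫ s, F s * U w s ∂mu01

theorem IsWeak.sub {g g' : E} {F F' : ℝ → ℝ} (h : IsWeak g F) (h' : IsWeak g' F')
    (hF : Continuous F) (hF' : Continuous F') : IsWeak (g - g') (fun s => F s - F' s) := by
  intro w
  simp_rw [sub_mul]
  rw [inner_sub_left, h w, h' w, integral_sub (integrable_of_continuous (by fun_prop))
    (integrable_of_continuous (by fun_prop))]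

/-- The energy estimate. -/
theorem IsWeak.norm_le {d : E} {F : ℝ → ℝ} {A K : ℝ} (h : IsWeak d F) (hF : Continuous F)
    (hA : 0 ≤ A) (hK : 0 ≤ K) (hb : ∀ s, |F s| ≤ A + K * |U d s|) :
    (1 - K * (4 / Real.pi ^ 2)) * ‖d‖ ≤ A := by
  have h1 : ‖d‖ ^ 2 ≤ ∫ s, (A * ‖d‖ + K * (|U d s| * |U d s|)) ∂mu01 := by
    rw [← real_inner_self_eq_norm_sq, h d]
    refine integral_mono (integrable_of_continuous (by fun_prop))
      (integrable_of_continuous (by fun_prop)) fun s => ?_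
    calc F s * U d s ≤ |F s| * |U d s| := by rw [← abs_mul]; exact le_abs_self _
      _ ≤ (A + K * |U d s|) * |U d s| := mul_le_mul_of_nonneg_right (hb s) (abs_nonneg _)
      _ = A * |U d s| + K * (|U d s| * |U d s|) := by ring
      _ ≤ _ := by gcongr; exact abs_U_le d s
  rw [integral_add (integrable_const _) (integrable_of_continuous (by fun_prop)),
    integral_const, probReal_univ, one_smul, integral_const_mul] at h1
  have h2 := mul_le_mul_of_nonneg_left (integral_abs_mul_abs_le d d) hK
  rcases (norm_nonneg d).eq_or_lt with hd | hd
  · rw [← hd]; simpa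
  · refine le_of_mul_le_mul_right ?_ hd
    nlinarith

theorem exists_isWeak {F : ℝ → ℝ} (hF : Continuous F) : ∃ g : E, IsWeak g F := by
  let L : E →ₗ[ℝ] ℝ :=
    { toFun := fun w => ∫ s, F s * U w s ∂mu01
      map_add' := fun v w => by
        simp_rw [U_add, mul_add]
        exact integral_add (integrable_of_continuous (by fun_prop))
          (integrable_of_continuous (by fun_prop))
      map_smul' := fun c w => by
        simp_rw [U_smul, RingHom.id_apply, smul_eq_mul]
        rw [← integral_const_mul]
        exact integral_congr_ae (Eventually.of_forall fun s => by ring) }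
  have hL : ∀ w, ‖L w‖ ≤ (∫ s, |F s| ∂mu01) * ‖w‖ := by
    intro w
    refine (norm_integral_le_integral_norm _).trans ?_
    rw [← integral_mul_const]
    refine integral_mono (integrable_of_continuous (by fun_prop))
      (integrable_of_continuous (by fun_prop)) fun s => ?_
    show ‖F s * U w s‖ ≤ |F s| * ‖w‖
    rw [norm_mul, Real.norm_eq_abs, Real.norm_eq_abs]
    exact mul_le_mul_of_nonneg_left (abs_U_le w s) (abs_nonneg _)
  refine ⟨(InnerProductSpace.toDual ℝ E).symm (L.mkContinuous _ hL), fun w => ?_⟩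
  rw [InnerProductSpace.toDual_symm_apply]
  rfl

theorem exists_isWeak_nonlinear {F : ℝ → ℝ → ℝ} (hF : Continuous (Function.uncurry F)) {K : ℝ}
    (hK : 0 ≤ K) (hK1 : K * (4 / Real.pi ^ 2) < 1)
    (hlip : ∀ s u v, |F s u - F s v| ≤ K * |u - v|) :
    ∃ g : E, IsWeak g (fun s => F s (U g s)) := by
  have hc : ∀ g : E, Continuous fun s => F s (U g s) := fun g =>
    hF.comp (continuous_id.prodMk (continuous_U g))
  choose Φ hΦ using fun g : E => exists_isWeak (hc g)
  have hq : 0 ≤ K * (4 / Real.pi ^ 2) := by positivity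
  have hcon : ContractingWith (NNReal.mk (K * (4 / Real.pi ^ 2)) hq) Φ := by
    refine ⟨by exact_mod_cast hK1, LipschitzWith.of_dist_le_mul fun f g => ?_⟩
    rw [dist_eq_norm, dist_eq_norm, NNReal.coe_mk]
    set d := Φ f - Φ g with hd
    have h1 : ‖d‖ ^ 2 ≤ ∫ s, K * (|U (f - g) s| * |U d s|) ∂mu01 := by
      rw [← real_inner_self_eq_norm_sq, ((hΦ f).sub (hΦ g) (hc f) (hc g)) d]
      refine integral_mono (integrable_of_continuous
        (((hc f).sub (hc g)).mul (continuous_U d))) (integrable_of_continuous (by fun_prop))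
        fun s => ?_
      calc (F s (U f s) - F s (U g s)) * U d s
          ≤ |F s (U f s) - F s (U g s)| * |U d s| := by rw [← abs_mul]; exact le_abs_self _
        _ ≤ (K * |U f s - U g s|) * |U d s| :=
          mul_le_mul_of_nonneg_right (hlip _ _ _) (abs_nonneg _)
        _ = K * (|U (f - g) s| * |U d s|) := by rw [U_sub f g]; ring
    rw [integral_const_mul] at h1
    have h2 := mul_le_mul_of_nonneg_left (integral_abs_mul_abs_le (f - g) d) hK
    rcases (norm_nonneg d).eq_or_lt with hd0 | hd0
    · rw [← hd0]; positivity
    · refine le_of_mul_le_mul_right ?_ hd0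
      nlinarith
  refine ⟨hcon.fixedPoint Φ, ?_⟩
  have h := hΦ (hcon.fixedPoint Φ)
  rwa [hcon.fixedPoint_isFixedPt] at h

theorem isStateSolF_iff {a : E} {p : ℝ × ℝ} {g : E} :
    IsStateSolF (U a) p g ↔ IsWeak g (fun s => edot p (Dmvec (U a s + U g s))) := by
  unfold IsStateSolF IsWeak
  simp_rw [integral_mul_eq_inner, sub_eq_zero]

theorem isAdjSolF_iff {a : E} {p : ℝ × ℝ} {g l : E} {f : ℝ → ℝ} (hf : Continuous f) :
    IsAdjSolF (U a) p g f l ↔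
      IsWeak l (fun s => U l s * edot p (D2mvec (U a s + U g s)) + (U g s - f s)) := by
  unfold IsAdjSolF IsWeak
  refine forall_congr' fun w => ?_
  simp_rw [integral_mul_eq_inner, add_mul]
  rw [integral_add (integrable_of_continuous (by fun_prop))
      (integrable_of_continuous (by fun_prop)),
    sub_eq_iff_eq_add']

theorem isWeak_design_iff {n : ℕ} {ε : ℝ} {h : Fin n → ℝ × ℝ} {a : E} {th l : Fin n → E} :
    (∀ w : E, ε * (∫ s, (a : ℝ → ℝ) s * (w : ℝ → ℝ) s ∂mu01)
      + ∑ i, (∫ s, U (l i) s * edot (h i) (D2mvec (U a s + U (th i) s)) * U w s ∂mu01) = 0) ↔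
    IsWeak (ε • a) (fun s => -∑ i, U (l i) s * edot (h i) (D2mvec (U a s + U (th i) s))) := by
  unfold IsWeak
  refine forall_congr' fun w => ?_
  simp_rw [integral_mul_eq_inner, neg_mul, Finset.sum_mul]
  rw [integral_neg, integral_finsetSum _ fun i _ => integrable_of_continuous (by fun_prop),
    real_inner_smul_left, eq_neg_iff_add_eq_zero]

theorem norm_state_le {a : E} {p : ℝ × ℝ} {g : E} (h : IsStateSolF (U a) p g) :
    ‖g‖ ≤ enorm2 p := by
  have := (isStateSolF_iff.1 h).norm_le (by fun_prop) (enorm2_nonneg p) le_rfl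
    fun s => by simpa using abs_edot_Dmvec_le p _
  simpa using this

theorem norm_state_sub_le {a a' : E} {p p' : ℝ × ℝ} {g g' : E} {K : ℝ}
    (h : IsStateSolF (U a) p g) (h' : IsStateSolF (U a') p' g') (hp' : enorm2 p' ≤ K) :
    (1 - K * (4 / Real.pi ^ 2)) * ‖g - g'‖ ≤ enorm2 (p - p') + K * ‖a - a'‖ := by
  have hK := (enorm2_nonneg p').trans hp'
  refine ((isStateSolF_iff.1 h).sub (isStateSolF_iff.1 h') (by fun_prop) (by fun_prop)).norm_le
    (by fun_prop) (add_nonneg (enorm2_nonneg _) (by positivity)) hK fun s => ?_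
  set u := U a s + U g s
  set u' := U a' s + U g' s
  have e : edot p (Dmvec u) - edot p' (Dmvec u') =
      edot (p - p') (Dmvec u) + (edot p' (Dmvec u) - edot p' (Dmvec u')) := by
    rw [edot_sub_left]; ring
  have hu : |u - u'| ≤ ‖a - a'‖ + |U (g - g') s| := by
    have : u - u' = U (a - a') s + U (g - g') s := by
      rw [U_sub, U_sub]; ring
    rw [this]
    exact (abs_add_le _ _).trans (add_le_add_left (abs_U_le _ _) _)
  have h1 : enorm2 p' * |u - u'| ≤ K * (‖a - a'‖ + |U (g - g') s|) :=
    mul_le_mul hp' hu (abs_nonneg _) hK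
  rw [e]
  linarith [abs_add_le (edot (p - p') (Dmvec u)) (edot p' (Dmvec u) - edot p' (Dmvec u')),
    abs_edot_Dmvec_le (p - p') u, abs_edot_Dmvec_sub_le p' u u']

theorem norm_adj_le {a : E} {p : ℝ × ℝ} {g l : E} {f : ℝ → ℝ} (hf : Continuous f) {K B : ℝ}
    (hB : ∀ s, |f s| ≤ B) (h : IsAdjSolF (U a) p g f l) (hp : enorm2 p ≤ K) :
    (1 - K * (4 / Real.pi ^ 2)) * ‖l‖ ≤ ‖g‖ + B := by
  have hK := (enorm2_nonneg p).trans hp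
  have hB0 := (abs_nonneg _).trans (hB 0)
  refine ((isAdjSolF_iff hf).1 h).norm_le (by fun_prop) (by positivity) hK fun s => ?_
  have h1 : |U l s * edot p (D2mvec (U a s + U g s))| ≤ |U l s| * K := by
    rw [abs_mul]
    exact mul_le_mul_of_nonneg_left ((abs_edot_D2mvec_le _ _).trans hp) (abs_nonneg _)
  linarith [abs_add_le (U l s * edot p (D2mvec (U a s + U g s))) (U g s - f s),
    abs_sub (U g s) (f s), abs_U_le g s, hB s]

theorem abs_mul_edot_D2mvec_sub_le (x x' : ℝ) (p p' : ℝ × ℝ) (u u' : ℝ) :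
    |x * edot p (D2mvec u) - x' * edot p' (D2mvec u')| ≤
      |x - x'| * enorm2 p + |x'| * (enorm2 (p - p') + enorm2 p' * |u - u'|) := by
  have e : x * edot p (D2mvec u) - x' * edot p' (D2mvec u') = (x - x') * edot p (D2mvec u) +
      x' * (edot (p - p') (D2mvec u) + (edot p' (D2mvec u) - edot p' (D2mvec u'))) := by
    rw [edot_sub_left]; ring
  rw [e]
  refine (abs_add_le _ _).trans ?_
  rw [abs_mul, abs_mul]
  gcongr
  · exact abs_edot_D2mvec_le _ _
  · refine (abs_add_le _ _).trans ?_
    gcongr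
    · exact abs_edot_D2mvec_le _ _
    · exact abs_edot_D2mvec_sub_le _ _ _

theorem abs_angle_sub_le (a a' g g' : E) (s : ℝ) :
    |(U a s + U g s) - (U a' s + U g' s)| ≤ ‖a - a'‖ + ‖g - g'‖ := by
  have : (U a s + U g s) - (U a' s + U g' s) = U (a - a') s + U (g - g') s := by
    rw [U_sub, U_sub]; ring
  rw [this]
  exact (abs_add_le _ _).trans (add_le_add (abs_U_le _ _) (abs_U_le _ _))

theorem norm_adj_sub_le {a a' : E} {p p' : ℝ × ℝ} {g g' l l' : E} {f : ℝ → ℝ} (hf : Continuous f)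
    {K M : ℝ} (h : IsAdjSolF (U a) p g f l) (h' : IsAdjSolF (U a') p' g' f l')
    (hp : enorm2 p ≤ K) (hp' : enorm2 p' ≤ K) (hM : ‖l'‖ ≤ M) :
    (1 - K * (4 / Real.pi ^ 2)) * ‖l - l'‖ ≤
      M * (enorm2 (p - p') + K * (‖a - a'‖ + ‖g - g'‖)) + ‖g - g'‖ := by
  have hK := (enorm2_nonneg p').trans hp'
  have hM0 := (norm_nonneg _).trans hM
  have he := enorm2_nonneg (p - p')
  refine (((isAdjSolF_iff hf).1 h).sub ((isAdjSolF_iff hf).1 h') (by fun_prop)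
    (by fun_prop)).norm_le (by fun_prop) (by positivity) hK fun s => ?_
  have h1 := abs_mul_edot_D2mvec_sub_le (U l s) (U l' s) p p' (U a s + U g s) (U a' s + U g' s)
  have h2 : |U l' s| * (enorm2 (p - p') + enorm2 p' * |(U a s + U g s) - (U a' s + U g' s)|) ≤
      M * (enorm2 (p - p') + K * (‖a - a'‖ + ‖g - g'‖)) := by
    have := enorm2_nonneg p'
    gcongr
    · exact (abs_U_le _ _).trans hM
    · exact abs_angle_sub_le a a' g g' s
  have h3 : |U l s - U l' s| * enorm2 p ≤ K * |U (l - l') s| := by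
    rw [U_sub, mul_comm]
    gcongr
  have h4 := abs_U_le (g - g') s
  rw [U_sub g g'] at h4
  have e : U l s * edot p (D2mvec (U a s + U g s)) + (U g s - f s) -
      (U l' s * edot p' (D2mvec (U a' s + U g' s)) + (U g' s - f s)) =
      (U l s * edot p (D2mvec (U a s + U g s)) - U l' s * edot p' (D2mvec (U a' s + U g' s))) +
      (U g s - U g' s) := by ring
  rw [e]
  linarith [abs_add_le (U l s * edot p (D2mvec (U a s + U g s)) -
    U l' s * edot p' (D2mvec (U a' s + U g' s))) (U g s - U g' s)]

theorem abs_integral_le_of_le {f : ℝ → ℝ} {C : ℝ} (h : ∀ s, |f s| ≤ C) :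
    |∫ s, f s ∂mu01| ≤ C := by
  simpa using norm_integral_le_of_norm_le_const (μ := mu01) (f := f) (C := C)
    (Eventually.of_forall h)

theorem abs_integral_mul_sub_le (a a' g g' l l' : E) {m : ℝ → ℝ} {M : ℝ} (hm : Continuous m)
    (hm1 : ∀ u, |m u| ≤ 1) (hlip : ∀ u v, |m u - m v| ≤ |u - v|) (hM : ‖l'‖ ≤ M) :
    |(∫ s, U l s * m (U a s + U g s) ∂mu01) - ∫ s, U l' s * m (U a' s + U g' s) ∂mu01| ≤
      ‖l - l'‖ + M * (‖a - a'‖ + ‖g - g'‖) := by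
  rw [← integral_sub (integrable_of_continuous (by fun_prop))
    (integrable_of_continuous (by fun_prop))]
  refine abs_integral_le_of_le fun s => ?_
  set u := U a s + U g s with hu
  set u' := U a' s + U g' s with hu'
  have e : U l s * m u - U l' s * m u' = U (l - l') s * m u + U l' s * (m u - m u') := by
    rw [U_sub]; ring
  rw [e]
  refine (abs_add_le _ _).trans ?_
  rw [abs_mul, abs_mul]
  have h1 : |U (l - l') s| * |m u| ≤ ‖l - l'‖ * 1 :=
    mul_le_mul (abs_U_le _ _) (hm1 u) (abs_nonneg _) (norm_nonneg _)
  have h2 : |U l' s| * |m u - m u'| ≤ M * (‖a - a'‖ + ‖g - g'‖) :=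
    mul_le_mul ((abs_U_le _ _).trans hM) ((hlip u u').trans (abs_angle_sub_le a a' g g' s))
      (abs_nonneg _) ((norm_nonneg _).trans hM)
  linarith

theorem mul_enorm2_sub_le {a a' : E} {p p' : ℝ × ℝ} {g g' l l' : E} {γ M : ℝ} (hγ : 0 ≤ γ)
    (h : γ * p.1 = -(∫ s, U l s * (Dmvec (U a s + U g s)).1 ∂mu01) ∧
      γ * p.2 = -(∫ s, U l s * (Dmvec (U a s + U g s)).2 ∂mu01))
    (h' : γ * p'.1 = -(∫ s, U l' s * (Dmvec (U a' s + U g' s)).1 ∂mu01) ∧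
      γ * p'.2 = -(∫ s, U l' s * (Dmvec (U a' s + U g' s)).2 ∂mu01)) (hM : ‖l'‖ ≤ M) :
    γ * enorm2 (p - p') ≤ 2 * (‖l - l'‖ + M * (‖a - a'‖ + ‖g - g'‖)) := by
  have h1 := abs_integral_mul_sub_le a a' g g' l l' (m := fun v => (Dmvec v).1) (by fun_prop)
    (fun v => by simpa using abs_fst_le_enorm2 (Dmvec v))
    (fun u v => (abs_fst_le_enorm2 (Dmvec u - Dmvec v)).trans (enorm2_Dmvec_sub_le u v)) hM
  have h2 := abs_integral_mul_sub_le a a' g g' l l' (m := fun v => (Dmvec v).2) (by fun_prop)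
    (fun v => by simpa using abs_snd_le_enorm2 (Dmvec v))
    (fun u v => (abs_snd_le_enorm2 (Dmvec u - Dmvec v)).trans (enorm2_Dmvec_sub_le u v)) hM
  have e1 : γ * |(p - p').1| = |(∫ s, U l s * (Dmvec (U a s + U g s)).1 ∂mu01)
      - ∫ s, U l' s * (Dmvec (U a' s + U g' s)).1 ∂mu01| := by
    have e : γ * |(p - p').1| = |γ * (p - p').1| := by rw [abs_mul, abs_of_nonneg hγ]
    rw [e, Prod.fst_sub, mul_sub, h.1, h'.1,
      ← abs_neg]
    congr 1
    ring
  have e2 : γ * |(p - p').2| = |(∫ s, U l s * (Dmvec (U a s + U g s)).2 ∂mu01)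
      - ∫ s, U l' s * (Dmvec (U a' s + U g' s)).2 ∂mu01| := by
    have e : γ * |(p - p').2| = |γ * (p - p').2| := by rw [abs_mul, abs_of_nonneg hγ]
    rw [e, Prod.snd_sub, mul_sub, h.2, h'.2,
      ← abs_neg]
    congr 1
    ring
  have h3 := mul_le_mul_of_nonneg_left (enorm2_le_abs_add_abs (p - p')) hγ
  linarith

theorem mul_enorm2_le {a : E} {p : ℝ × ℝ} {g l : E} {γ M : ℝ} (hγ : 0 ≤ γ)
    (h : γ * p.1 = -(∫ s, U l s * (Dmvec (U a s + U g s)).1 ∂mu01) ∧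
      γ * p.2 = -(∫ s, U l s * (Dmvec (U a s + U g s)).2 ∂mu01)) (hM : ‖l‖ ≤ M) :
    γ * enorm2 p ≤ 2 * M := by
  have h1 := mul_enorm2_sub_le (a := a) (a' := a) (p' := 0) (g := g) (g' := g) (l' := 0) (M := 0)
    hγ h (by simp) (by simp)
  simp only [sub_zero, sub_self, norm_zero, zero_mul, add_zero] at h1
  linarith

theorem norm_design_sub_le {n : ℕ} {tb : Fin n → ℝ → ℝ} {ε γ : ℝ} (hε : 0 < ε)
    {h h' : Fin n → ℝ × ℝ} {a a' : E} {th th' l l' : Fin n → E}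
    (H : SolEQ tb ε γ h a th l) (H' : SolEQ tb ε γ h' a' th' l') {M κ : ℝ}
    (hM : ∀ i, ‖l' i‖ ≤ M) (hκ : ∀ i, enorm2 (h i) ≤ κ) (hκ' : ∀ i, enorm2 (h' i) ≤ κ) :
    ε * ‖a - a'‖ ≤ ∑ i, (‖l i - l' i‖ * κ +
      M * (enorm2 (h i - h' i) + κ * (‖a - a'‖ + ‖th i - th' i‖))) := by
  have h1 := ((isWeak_design_iff.1 H.2.2.1).sub (isWeak_design_iff.1 H'.2.2.1) (by fun_prop)
    (by fun_prop)).norm_le (K := 0) (by fun_prop) (A := ∑ i, (‖l i - l' i‖ * κ +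
      M * (enorm2 (h i - h' i) + κ * (‖a - a'‖ + ‖th i - th' i‖)))) ?_ le_rfl ?_
  · rwa [zero_mul, sub_zero, one_mul, ← smul_sub, norm_smul, Real.norm_of_nonneg hε.le] at h1
  · refine Finset.sum_nonneg fun i _ => ?_
    have := enorm2_nonneg (h i - h' i)
    have := (enorm2_nonneg _).trans (hκ i)
    have := (norm_nonneg _).trans (hM i)
    positivity
  · intro s
    rw [zero_mul, add_zero, neg_sub_neg, ← Finset.sum_sub_distrib]
    refine (Finset.abs_sum_le_sum_abs _ _).trans (Finset.sum_le_sum fun i _ => ?_)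
    rw [abs_sub_comm]
    have hκ0 := (enorm2_nonneg _).trans (hκ i)
    have hM0 := (norm_nonneg _).trans (hM i)
    have he := enorm2_nonneg (h i - h' i)
    refine (abs_mul_edot_D2mvec_sub_le _ _ _ _ _ _).trans ?_
    rw [← U_sub]
    have := enorm2_nonneg (h' i)
    gcongr
    · exact enorm2_nonneg _
    · exact abs_U_le _ _
    · exact hκ i
    · exact (abs_U_le _ _).trans (hM i)
    · exact hκ' i
    · exact abs_angle_sub_le _ _ _ _ s

theorem one_sub_pos_of_lt {K : ℝ} (hK : K < Real.pi ^ 2 / 4) :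
    0 < 1 - K * (4 / Real.pi ^ 2) := by
  have := Real.pi_pos
  have h : K * (4 / Real.pi ^ 2) < Real.pi ^ 2 / 4 * (4 / Real.pi ^ 2) := by gcongr
  have e : Real.pi ^ 2 / 4 * (4 / Real.pi ^ 2) = 1 := by field_simp
  linarith

/-- The uniqueness theorem for (EQ). -/
theorem exists_uniqueness_threshold {n : ℕ} {tb : Fin n → ℝ → ℝ} (htb : ∀ i, Continuous (tb i))
    {B : ℝ} (hB : ∀ i s, |tb i s| ≤ B) (hB0 : 0 ≤ B) {ε : ℝ} (hε : 0 < ε) {K : ℝ} (hK0 : 0 < K)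
    (hK : K < Real.pi ^ 2 / 4) :
    ∃ γstar : ℝ, ∀ γ : ℝ, γstar < γ →
      ∀ (h h' : Fin n → ℝ × ℝ) (a a' : E) (th th' l l' : Fin n → E),
        SolEQ tb ε γ h a th l → SolEQ tb ε γ h' a' th' l' →
        (∀ i, enorm2 (h i) ≤ K) → (∀ i, enorm2 (h' i) ≤ K) →
        h' = h ∧ a' = a ∧ th' = th ∧ l' = l := by
  set ρ := 1 - K * (4 / Real.pi ^ 2)
  have hρ : 0 < ρ := one_sub_pos_of_lt hK
  set M := (K + B) / ρ with hMdef
  have hM0 : 0 < M := by positivity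
  set C₁ := (1 + K) / ρ with hC₁
  set C₂ := (M * (1 + K) + (M * K + 1) * C₁) / ρ with hC₂
  set C₃ := 2 * (C₂ + M + M * C₁) with hC₃
  set C₄ := 4 * M * C₂ + 2 * M * C₃ + 2 * M ^ 2 * (1 + 2 * C₁) with hC₄
  have hC₁0 : 0 < C₁ := by positivity
  have hC₂0 : 0 < C₂ := by positivity
  have hC₃0 : 0 < C₃ := by positivity
  have hC₄0 : 0 < C₄ := by positivity
  refine ⟨max (2 * C₃) (n * C₄ / ε), fun γ hγ h h' a a' th th' l l' H H' hh hh' => ?_⟩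
  have hγ₁ : 2 * C₃ < γ := (le_max_left _ _).trans_lt hγ
  have hγ₂ : n * C₄ / ε < γ := (le_max_right _ _).trans_lt hγ
  have hγ0 : 0 < γ := by linarith
  have adj_bound : ∀ {h : Fin n → ℝ × ℝ} {a : E} {th l : Fin n → E}, SolEQ tb ε γ h a th l →
      (∀ i, enorm2 (h i) ≤ K) → ∀ i, ‖l i‖ ≤ M := fun H hh i => by
    rw [hMdef, le_div_iff₀' hρ]
    exact (norm_adj_le (htb i) (hB i) (H.2.1 i) (hh i)).trans
      (by linarith [norm_state_le (H.1 i), hh i])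
  have hl := adj_bound H hh
  have hl' := adj_bound H' hh'
  have small : ∀ {h : Fin n → ℝ × ℝ} {a : E} {th l : Fin n → E}, SolEQ tb ε γ h a th l →
      (∀ i, ‖l i‖ ≤ M) → ∀ i, enorm2 (h i) ≤ 2 * M / γ := fun H hl i => by
    rw [le_div_iff₀' hγ0]
    exact mul_enorm2_le hγ0.le (H.2.2.2 i) (hl i)
  set D := ‖a - a'‖ with hD
  have hD0 : 0 ≤ D := norm_nonneg _
  have est : ∀ i, ‖th i - th' i‖ ≤ C₁ * (enorm2 (h i - h' i) + D) ∧
      ‖l i - l' i‖ ≤ C₂ * (enorm2 (h i - h' i) + D) ∧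
      γ * enorm2 (h i - h' i) ≤ 2 * C₃ * D := by
    intro i
    set e := enorm2 (h i - h' i)
    have he : 0 ≤ e := enorm2_nonneg _
    have h1 : ‖th i - th' i‖ ≤ C₁ * (e + D) := by
      rw [hC₁, div_mul_eq_mul_div, le_div_iff₀' hρ]
      refine (norm_state_sub_le (H.1 i) (H'.1 i) (hh' i)).trans ?_
      nlinarith
    have h2 : ‖l i - l' i‖ ≤ C₂ * (e + D) := by
      rw [hC₂, div_mul_eq_mul_div, le_div_iff₀' hρ]
      refine (norm_adj_sub_le (htb i) (H.2.1 i) (H'.2.1 i) (hh i) (hh' i) (hl' i)).trans ?_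
      have h3 := mul_le_mul_of_nonneg_left h1 (by positivity : 0 ≤ M * K + 1)
      have h4 : 0 ≤ M * D := by positivity
      have h5 : 0 ≤ M * K * e := by positivity
      linarith
    refine ⟨h1, h2, ?_⟩
    have h3 := mul_enorm2_sub_le hγ0.le (H.2.2.2 i) (H'.2.2.2 i) (hl' i)
    have h4 := mul_le_mul_of_nonneg_left h1 hM0.le
    have h5 : γ * e ≤ C₃ * (e + D) := by
      have h6 : 0 ≤ M * e := by positivity
      rw [hC₃]
      linarith
    nlinarith
  have hDz : D = 0 := by
    have h1 := mul_le_mul_of_nonneg_left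
      (norm_design_sub_le hε H H' hl' (small H hl) (small H' hl')) hγ0.le
    rw [Finset.mul_sum, ← hD] at h1
    have h2 : ∀ i ∈ Finset.univ, γ * (‖l i - l' i‖ * (2 * M / γ) +
        M * (enorm2 (h i - h' i) + 2 * M / γ * (D + ‖th i - th' i‖))) ≤ C₄ * D := by
      intro i _
      obtain ⟨e1, e2, e3⟩ := est i
      have he : enorm2 (h i - h' i) ≤ D := by
        refine le_of_mul_le_mul_left ?_ hγ0
        nlinarith
      have e4 : ‖th i - th' i‖ ≤ C₁ * (2 * D) := e1.trans (by gcongr; linarith)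
      have e5 : ‖l i - l' i‖ ≤ C₂ * (2 * D) := e2.trans (by gcongr; linarith)
      have e6 : γ * (‖l i - l' i‖ * (2 * M / γ) +
        M * (enorm2 (h i - h' i) + 2 * M / γ * (D + ‖th i - th' i‖))) =
        2 * M * ‖l i - l' i‖ + M * (γ * enorm2 (h i - h' i)) +
          2 * M ^ 2 * (D + ‖th i - th' i‖) := by
        field_simp
        ring
      rw [e6, hC₄]
      have e7 := mul_le_mul_of_nonneg_left e5 (by positivity : 0 ≤ 2 * M)
      have e8 := mul_le_mul_of_nonneg_left e3 hM0.le
      have e9 := mul_le_mul_of_nonneg_left e4 (by positivity : 0 ≤ 2 * M ^ 2)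
      linarith
    have h3 := h1.trans (Finset.sum_le_sum h2)
    rw [Finset.sum_const, Finset.card_univ, Fintype.card_fin, nsmul_eq_mul] at h3
    rw [div_lt_iff₀ hε] at hγ₂
    by_contra hne
    have hDpos : 0 < D := lt_of_le_of_ne hD0 (Ne.symm hne)
    nlinarith
  have hez : ∀ i, enorm2 (h i - h' i) = 0 := fun i => by
    have h1 := (est i).2.2
    rw [hDz, mul_zero] at h1
    exact le_antisymm (by nlinarith) (enorm2_nonneg _)
  refine ⟨funext fun i => ?_, ?_, funext fun i => ?_, funext fun i => ?_⟩
  · have h1 := abs_fst_le_enorm2 (h i - h' i)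
    have h2 := abs_snd_le_enorm2 (h i - h' i)
    rw [hez i] at h1 h2
    exact (sub_eq_zero.1 (Prod.ext (abs_nonpos_iff.1 h1) (abs_nonpos_iff.1 h2))).symm
  · exact (sub_eq_zero.1 (norm_eq_zero.1 hDz)).symm
  · have h1 := (est i).1
    rw [hDz, hez i, add_zero, mul_zero] at h1
    exact (sub_eq_zero.1 (norm_le_zero_iff.1 h1)).symm
  · have h1 := (est i).2.1
    rw [hDz, hez i, add_zero, mul_zero] at h1
    exact (sub_eq_zero.1 (norm_le_zero_iff.1 h1)).symm

theorem exists_weakly_convergent_subseq {x : ℕ → E} {R : ℝ} (hx : ∀ k, ‖x k‖ ≤ R) :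
    ∃ (a : E) (φ : ℕ → ℕ), StrictMono φ ∧
      ∀ w, Tendsto (fun k => inner ℝ (x (φ k)) w) atTop (𝓝 (inner ℝ a w)) := by
  have : Fact ((2 : ℝ≥0∞) ≠ ⊤) := ⟨by norm_num⟩
  obtain ⟨y, -, φ, hφ, hy⟩ := WeakDual.isSeqCompact_closedBall ℝ E 0 R
    (x := fun k => StrongDual.toWeakDual (InnerProductSpace.toDual ℝ E (x k)))
    (fun k => by
      show dist _ _ ≤ R
      rw [dist_zero_right]
      exact ((InnerProductSpace.toDual ℝ E).norm_map (x k)).trans_le (hx k))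
  refine ⟨(InnerProductSpace.toDual ℝ E).symm (WeakDual.toStrongDual y), φ, hφ, fun w => ?_⟩
  rw [InnerProductSpace.toDual_symm_apply]
  exact ((WeakDual.eval_continuous w).tendsto y).comp hy

theorem exists_weakly_convergent_subseq_pi {R : ℝ} :
    ∀ {n : ℕ} {x : ℕ → Fin n → E}, (∀ k i, ‖x k i‖ ≤ R) →
      ∃ (a : Fin n → E) (φ : ℕ → ℕ), StrictMono φ ∧
        ∀ i w, Tendsto (fun k => inner ℝ (x (φ k) i) w) atTop (𝓝 (inner ℝ (a i) w))
  | 0, _, _ => ⟨fun i => i.elim0, id, strictMono_id, fun i => i.elim0⟩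
  | n + 1, x, hx => by
    obtain ⟨a, φ, hφ, ha⟩ :=
      exists_weakly_convergent_subseq_pi (x := fun k i => x k (Fin.succ i)) fun k i => hx k _
    obtain ⟨b, ψ, hψ, hb⟩ :=
      exists_weakly_convergent_subseq (x := fun k => x (φ k) 0) fun k => hx _ 0
    refine ⟨Fin.cons b a, φ ∘ ψ, hφ.comp hψ, fun i w => ?_⟩
    refine Fin.cases ?_ (fun j => ?_) i
    · simpa using hb w
    · exact (ha j w).comp hψ.tendsto_atTop

theorem tendsto_U {x : ℕ → E} {a : E}
    (h : ∀ w, Tendsto (fun k => inner ℝ (x k) w) atTop (𝓝 (inner ℝ a w))) (s : ℝ) :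
    Tendsto (fun k => U (x k) s) atTop (𝓝 (U a s)) := by
  simp_rw [U_eq_inner, real_inner_comm _ (evalVec s)]
  exact h _

@[fun_prop] theorem continuous_enorm2 : Continuous enorm2 := by
  unfold enorm2; fun_prop

theorem tendsto_edot_Dmvec {p : ℕ → ℝ × ℝ} {p₀ : ℝ × ℝ} {v : ℕ → ℝ} {v₀ : ℝ}
    (hp : Tendsto p atTop (𝓝 p₀)) (hv : Tendsto v atTop (𝓝 v₀)) :
    Tendsto (fun k => edot (p k) (Dmvec (v k))) atTop (𝓝 (edot p₀ (Dmvec v₀))) := by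
  have hc : Continuous fun q : (ℝ × ℝ) × ℝ => edot q.1 (Dmvec q.2) := by
    unfold edot Dmvec; fun_prop
  exact (hc.tendsto (p₀, v₀)).comp (hp.prodMk_nhds hv)

theorem isStateSolF_of_tendsto {p : ℕ → ℝ × ℝ} {p₀ : ℝ × ℝ} {a g : ℕ → E} {a₀ g₀ : E} {R : ℝ}
    (hR : ∀ k, enorm2 (p k) ≤ R) (hp : Tendsto p atTop (𝓝 p₀))
    (ha : ∀ w, Tendsto (fun k => inner ℝ (a k) w) atTop (𝓝 (inner ℝ a₀ w)))
    (hg : ∀ w, Tendsto (fun k => inner ℝ (g k) w) atTop (𝓝 (inner ℝ g₀ w)))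
    (h : ∀ k, IsStateSolF (U (a k)) (p k) (g k)) : IsStateSolF (U a₀) p₀ g₀ := by
  rw [isStateSolF_iff]
  intro w
  refine tendsto_nhds_unique (hg w) ?_
  simp_rw [fun k => isStateSolF_iff.1 (h k) w]
  refine tendsto_integral_of_dominated_convergence (fun _ => R * ‖w‖)
    (fun k => Continuous.aestronglyMeasurable (by fun_prop)) (integrable_const _)
    (fun k => Eventually.of_forall fun s => ?_) (Eventually.of_forall fun s => ?_)
  · rw [norm_mul, Real.norm_eq_abs, Real.norm_eq_abs]
    exact mul_le_mul ((abs_edot_Dmvec_le _ _).trans (hR k)) (abs_U_le w s) (abs_nonneg _)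
      ((enorm2_nonneg _).trans (hR k))
  · exact (tendsto_edot_Dmvec hp ((tendsto_U ha s).add (tendsto_U hg s))).mul_const _

theorem tendsto_integral_sq {f : ℝ → ℝ} (hf : Continuous f) {B R : ℝ} (hB : ∀ s, |f s| ≤ B)
    {g : ℕ → E} {g₀ : E} (hR : ∀ k, ‖g k‖ ≤ R)
    (hg : ∀ w, Tendsto (fun k => inner ℝ (g k) w) atTop (𝓝 (inner ℝ g₀ w))) :
    Tendsto (fun k => ∫ s, (U (g k) s - f s) ^ 2 ∂mu01) atTop
      (𝓝 (∫ s, (U g₀ s - f s) ^ 2 ∂mu01)) := by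
  refine tendsto_integral_of_dominated_convergence (fun _ => (R + B) ^ 2)
    (fun k => Continuous.aestronglyMeasurable (by fun_prop)) (integrable_const _)
    (fun k => Eventually.of_forall fun s => ?_) (Eventually.of_forall fun s => ?_)
  · rw [norm_pow, Real.norm_eq_abs]
    have h1 := abs_sub (U (g k) s) (f s)
    have h2 := abs_U_le (g k) s
    have h3 := hR k
    have h4 := hB s
    gcongr
    linarith
  · exact ((tendsto_U hg s).sub_const _).pow 2

theorem cost_zero {n : ℕ} (tb : Fin n → ℝ → ℝ) (ε γ : ℝ) :
    cost tb ε γ (0 : Hn n) = (1 / 2) * ∑ i, ∫ s, (tb i s) ^ 2 ∂mu01 := by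
  simp [cost, enorm2]

theorem admissible_zero (n : ℕ) : Admissible (0 : Hn n) := by
  intro i
  rw [isStateSolF_iff]
  intro w
  simp [edot]

theorem cost_nonneg {n : ℕ} (tb : Fin n → ℝ → ℝ) {ε γ : ℝ} (hε : 0 < ε) (hγ : 0 < γ) (x : Hn n) :
    0 ≤ cost tb ε γ x := by
  unfold cost
  have h1 : 0 ≤ ∑ i, ∫ s, (U (x.2.2 i) s - tb i s) ^ 2 ∂mu01 :=
    Finset.sum_nonneg fun i _ => integral_nonneg fun s => sq_nonneg _
  have h2 : 0 ≤ ∫ s, ((x.2.1 : ℝ → ℝ) s) ^ 2 ∂mu01 := integral_nonneg fun s => sq_nonneg _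
  positivity

theorem mul_sq_enorm2_le_of_cost_le {n : ℕ} {tb : Fin n → ℝ → ℝ} {ε γ : ℝ} (hε : 0 < ε)
    (hγ : 0 < γ) {x : Hn n} {c : ℝ} (h : cost tb ε γ x ≤ c) (i : Fin n) :
    γ * enorm2 (x.1 i) ^ 2 ≤ 2 * c := by
  unfold cost at h
  have h1 : 0 ≤ ∑ i, ∫ s, (U (x.2.2 i) s - tb i s) ^ 2 ∂mu01 :=
    Finset.sum_nonneg fun i _ => integral_nonneg fun s => sq_nonneg _
  have h2 : 0 ≤ ε * ∫ s, ((x.2.1 : ℝ → ℝ) s) ^ 2 ∂mu01 :=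
    mul_nonneg hε.le (integral_nonneg fun s => sq_nonneg _)
  have h3 := Finset.single_le_sum (f := fun i => enorm2 (x.1 i) ^ 2) (fun i _ => sq_nonneg _)
    (Finset.mem_univ i)
  have h4 := mul_le_mul_of_nonneg_left h3 hγ.le
  beta_reduce at h4
  linarith

theorem mul_sq_norm_le_of_cost_le {n : ℕ} {tb : Fin n → ℝ → ℝ} {ε γ : ℝ} (hγ : 0 < γ) {x : Hn n}
    {c : ℝ} (h : cost tb ε γ x ≤ c) : ε * ‖x.2.1‖ ^ 2 ≤ 2 * c := by
  unfold cost at h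
  rw [integral_sq_eq_norm_sq] at h
  have h1 : 0 ≤ ∑ i, ∫ s, (U (x.2.2 i) s - tb i s) ^ 2 ∂mu01 :=
    Finset.sum_nonneg fun i _ => integral_nonneg fun s => sq_nonneg _
  have h3 : 0 ≤ γ * ∑ i, enorm2 (x.1 i) ^ 2 :=
    mul_nonneg hγ.le (Finset.sum_nonneg fun i _ => sq_nonneg _)
  linarith

/-- The direct method of the calculus of variations. -/
theorem exists_minimizer {n : ℕ} {tb : Fin n → ℝ → ℝ} (htb : ∀ i, Continuous (tb i))
    {B : ℝ} (hB : ∀ i s, |tb i s| ≤ B) {ε γ : ℝ} (hε : 0 < ε) (hγ : 0 < γ) :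
    ∃ x : Hn n, Admissible x ∧ ∀ y : Hn n, Admissible y → cost tb ε γ x ≤ cost tb ε γ y := by
  set S : Set ℝ := cost tb ε γ '' {x | Admissible x} with hS
  have hSne : S.Nonempty := ⟨_, mem_image_of_mem _ (admissible_zero n)⟩
  have hSbd : BddBelow S := ⟨0, by rintro _ ⟨x, -, rfl⟩; exact cost_nonneg tb hε hγ x⟩
  obtain ⟨u, -, hu, huS⟩ := exists_seq_tendsto_sInf hSne hSbd
  choose X hXA hXu using huS
  obtain ⟨c, hc⟩ := hu.bddAbove_range
  have hcost : ∀ k, cost tb ε γ (X k) ≤ c := fun k => (hXu k).trans_le (hc (mem_range_self k))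
  have hc0 : 0 ≤ c := (cost_nonneg tb hε hγ _).trans (hcost 0)
  set R := √(2 * c / γ) with hR
  have hRh : ∀ k i, enorm2 ((X k).1 i) ≤ R := fun k i => by
    rw [hR, Real.le_sqrt (enorm2_nonneg _) (by positivity), le_div_iff₀' hγ]
    exact mul_sq_enorm2_le_of_cost_le hε hγ (hcost k) i
  have hRa : ∀ k, ‖(X k).2.1‖ ≤ √(2 * c / ε) := fun k => by
    rw [Real.le_sqrt (norm_nonneg _) (by positivity), le_div_iff₀' hε]
    exact mul_sq_norm_le_of_cost_le hγ (hcost k)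
  have hRt : ∀ k i, ‖(X k).2.2 i‖ ≤ R := fun k i => (norm_state_le (hXA k i)).trans (hRh k i)
  have hbd : ∀ k, (X k).1 ∈ Metric.closedBall (0 : Fin n → ℝ × ℝ) R := fun k => by
    rw [mem_closedBall_zero_iff, pi_norm_le_iff_of_nonneg (Real.sqrt_nonneg _)]
    intro i
    rw [norm_prod_le_iff]
    exact ⟨(abs_fst_le_enorm2 _).trans (hRh k i), (abs_snd_le_enorm2 _).trans (hRh k i)⟩
  obtain ⟨h, -, φ₁, hφ₁, hh⟩ := tendsto_subseq_of_bounded Metric.isBounded_closedBall hbd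
  obtain ⟨a, φ₂, hφ₂, ha⟩ := exists_weakly_convergent_subseq fun k => hRa (φ₁ k)
  obtain ⟨t, φ₃, hφ₃, ht⟩ := exists_weakly_convergent_subseq_pi fun k => hRt (φ₁ (φ₂ k))
  set φ := φ₁ ∘ φ₂ ∘ φ₃ with hφ
  have hφm : StrictMono φ := hφ₁.comp (hφ₂.comp hφ₃)
  have hh' : ∀ i, Tendsto (fun k => (X (φ k)).1 i) atTop (𝓝 (h i)) := fun i =>
    (tendsto_pi_nhds.1 hh i).comp (hφ₂.comp hφ₃).tendsto_atTop
  have ha' : ∀ w, Tendsto (fun k => inner ℝ (X (φ k)).2.1 w) atTop (𝓝 (inner ℝ a w)) := fun w =>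
    (ha w).comp hφ₃.tendsto_atTop
  refine ⟨(h, a, t), fun i => ?_, fun y hy => ?_⟩
  · exact isStateSolF_of_tendsto (fun k => hRh (φ k) i) (hh' i) ha' (ht i) fun k => hXA (φ k) i
  · refine le_trans ?_ (csInf_le hSbd (mem_image_of_mem _ hy))
    have hlim : Tendsto (fun k => (1 / 2) * ∑ i, (∫ s, (U ((X (φ k)).2.2 i) s - tb i s) ^ 2 ∂mu01)
        + (ε / 2) * (2 * inner ℝ (X (φ k)).2.1 a - ‖a‖ ^ 2)
        + (γ / 2) * ∑ i, (enorm2 ((X (φ k)).1 i)) ^ 2) atTop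
        (𝓝 ((1 / 2) * ∑ i, (∫ s, (U (t i) s - tb i s) ^ 2 ∂mu01)
        + (ε / 2) * (2 * inner ℝ a a - ‖a‖ ^ 2) + (γ / 2) * ∑ i, (enorm2 (h i)) ^ 2)) := by
      refine (((tendsto_finsetSum _ fun i _ => ?_).const_mul _).add
        ((((ha' a).const_mul 2).sub_const _).const_mul _)).add
        ((tendsto_finsetSum _ fun i _ => ?_).const_mul _)
      · exact tendsto_integral_sq (htb i) (hB i) (fun k => hRt (φ k) i) (ht i)
      · exact ((continuous_enorm2.tendsto _).comp (hh' i)).pow 2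
    have hlim' : Tendsto (fun k => cost tb ε γ (X (φ k))) atTop (𝓝 (sInf S)) := by
      simp_rw [hXu]
      exact hu.comp hφm.tendsto_atTop
    have hle := le_of_tendsto_of_tendsto' hlim hlim' fun k => by
      unfold cost
      rw [integral_sq_eq_norm_sq]
      have h1 := norm_sub_sq_real (X (φ k)).2.1 a
      have h2 : 2 * inner ℝ (X (φ k)).2.1 a - ‖a‖ ^ 2 ≤ ‖(X (φ k)).2.1‖ ^ 2 := by
        linarith [sq_nonneg ‖(X (φ k)).2.1 - a‖]
      gcongr
    refine le_trans (le_of_eq ?_) hle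
    unfold cost
    rw [integral_sq_eq_norm_sq, real_inner_self_eq_norm_sq]
    ring

theorem exists_state (a : E) {p : ℝ × ℝ} (hp : enorm2 p < Real.pi ^ 2 / 4) :
    ∃ g, IsStateSolF (U a) p g := by
  simp_rw [isStateSolF_iff]
  refine exists_isWeak_nonlinear (F := fun s v => edot p (Dmvec (U a s + v)))
    ?_ (enorm2_nonneg p) (by linarith [one_sub_pos_of_lt hp]) fun s u v => ?_
  · dsimp only [Function.uncurry_def]
    fun_prop
  · simpa using abs_edot_Dmvec_sub_le p (U a s + u) (U a s + v)

theorem exists_adjoint (a g : E) {p : ℝ × ℝ} (hp : enorm2 p < Real.pi ^ 2 / 4) {f : ℝ → ℝ}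
    (hf : Continuous f) : ∃ l, IsAdjSolF (U a) p g f l := by
  simp_rw [isAdjSolF_iff hf]
  refine exists_isWeak_nonlinear
    (F := fun s v => v * edot p (D2mvec (U a s + U g s)) + (U g s - f s))
    ?_ (enorm2_nonneg p) (by linarith [one_sub_pos_of_lt hp]) fun s u v => ?_
  · dsimp only [Function.uncurry_def]
    fun_prop
  · rw [add_sub_add_right_eq_sub, ← sub_mul, abs_mul, mul_comm]
    exact mul_le_mul_of_nonneg_right (abs_edot_D2mvec_le _ _) (abs_nonneg _)

theorem tracking_le {a β g g' l : E} {p η : ℝ × ℝ} {f : ℝ → ℝ} {t D : ℝ} (hf : Continuous f)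
    (hg : IsStateSolF (U a) p g) (hg' : IsStateSolF (U (a + t • β)) (p + t • η) g')
    (hl : IsAdjSolF (U a) p g f l) (hD : |t| * ‖β‖ + ‖g' - g‖ ≤ D) :
    1 / 2 * (∫ s, (U g' s - f s) ^ 2 ∂mu01) ≤ 1 / 2 * (∫ s, (U g s - f s) ^ 2 ∂mu01)
      + t * ((∫ s, U l s * edot p (D2mvec (U a s + U g s)) * U β s ∂mu01)
        + ∫ s, U l s * edot η (Dmvec (U a s + U g s)) ∂mu01)
      + (‖l‖ * (|t| * enorm2 η * D + enorm2 p * D ^ 2) + 1 / 2 * D ^ 2) := by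
  have hD0 : 0 ≤ D := le_trans (by positivity) hD
  have hadj := (isAdjSolF_iff hf).1 hl (g' - g)
  have hst := ((isStateSolF_iff.1 hg').sub (isStateSolF_iff.1 hg) (by fun_prop) (by fun_prop)) l
  rw [real_inner_comm] at hst
  set d : ℝ → ℝ := fun s => t * U β s + U (g' - g) s with hd
  have hdc : Continuous d := by fun_prop
  have hdD : ∀ s, |d s| ≤ D := fun s => by
    refine ((abs_add_le _ _).trans (add_le_add ?_ (abs_U_le _ _))).trans hD
    rw [abs_mul]
    exact mul_le_mul_of_nonneg_left (abs_U_le _ _) (abs_nonneg _)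
  have hang : ∀ s, U (a + t • β) s + U g' s = U a s + U g s + d s := fun s => by
    simp only [hd, U_add, U_smul, U_sub]; ring
  set R : ℝ → ℝ := fun s => U l s * (t * (edot η (Dmvec (U a s + U g s + d s)) -
    edot η (Dmvec (U a s + U g s))) + (edot p (Dmvec (U a s + U g s + d s)) -
    edot p (Dmvec (U a s + U g s)) - edot p (D2mvec (U a s + U g s)) * d s))
    + 1 / 2 * U (g' - g) s ^ 2 with hR
  have hRc : Continuous R := by fun_prop
  have hRb : ∫ s, R s ∂mu01 ≤ ‖l‖ * (|t| * enorm2 η * D + enorm2 p * D ^ 2) + 1 / 2 * D ^ 2 := by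
    refine (le_abs_self _).trans (abs_integral_le_of_le fun s => ?_)
    have h1 := abs_edot_Dmvec_sub_le η (U a s + U g s + d s) (U a s + U g s)
    rw [add_sub_cancel_left] at h1
    have h2 := abs_edot_Dmvec_taylor_le p (U a s + U g s) (d s)
    have h3 : |d s| ^ 2 ≤ D ^ 2 := pow_le_pow_left₀ (abs_nonneg _) (hdD s) 2
    have h4 : |U (g' - g) s| ^ 2 ≤ D ^ 2 := pow_le_pow_left₀ (abs_nonneg _)
      ((abs_U_le _ _).trans
        (le_trans (by linarith [mul_nonneg (abs_nonneg t) (norm_nonneg β)]) hD)) 2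
    rw [sq_abs] at h3
    have hp := enorm2_nonneg p
    have hη := enorm2_nonneg η
    refine (abs_add_le _ _).trans (add_le_add ?_ ?_)
    · rw [abs_mul]
      refine mul_le_mul (abs_U_le _ _) ((abs_add_le _ _).trans (add_le_add ?_ ?_))
        (abs_nonneg _) (norm_nonneg _)
      · rw [abs_mul, mul_assoc]
        exact mul_le_mul_of_nonneg_left
          (h1.trans (mul_le_mul_of_nonneg_left (hdD s) hη)) (abs_nonneg _)
      · exact h2.trans (mul_le_mul_of_nonneg_left h3 hp)
    · rw [abs_mul, abs_pow, abs_of_pos one_half_pos]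
      exact mul_le_mul_of_nonneg_left h4 one_half_pos.le
  have key : 1 / 2 * (∫ s, (U g' s - f s) ^ 2 ∂mu01) - 1 / 2 * (∫ s, (U g s - f s) ^ 2 ∂mu01)
      - t * ((∫ s, U l s * edot p (D2mvec (U a s + U g s)) * U β s ∂mu01)
        + ∫ s, U l s * edot η (Dmvec (U a s + U g s)) ∂mu01)
      + (∫ s, (edot (p + t • η) (Dmvec (U (a + t • β) s + U g' s))
          - edot p (Dmvec (U a s + U g s))) * U l s ∂mu01)
      - (∫ s, (U l s * edot p (D2mvec (U a s + U g s)) + (U g s - f s)) * U (g' - g) s ∂mu01)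
      = ∫ s, R s ∂mu01 := by
    rw [← integral_const_mul, ← integral_const_mul, ← integral_sub, ← integral_add,
      ← integral_const_mul, ← integral_sub, ← integral_add, ← integral_sub]
    · refine integral_congr_ae (.of_forall fun s => ?_)
      simp only [hR, hang, edot_add_left, edot_smul_left]
      simp only [hd, U_sub]
      ring
    all_goals exact integrable_of_continuous (by fun_prop)
  linarith

theorem exists_tracking_le {a β g l : E} {p η : ℝ × ℝ} {f : ℝ → ℝ} {K : ℝ} (hf : Continuous f)
    (hK : K < Real.pi ^ 2 / 4) (hp : enorm2 p ≤ K)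
    (hg : IsStateSolF (U a) p g) (hl : IsAdjSolF (U a) p g f l) :
    ∃ C : ℝ, ∀ (t : ℝ) (g' : E), IsStateSolF (U (a + t • β)) (p + t • η) g' →
      1 / 2 * (∫ s, (U g' s - f s) ^ 2 ∂mu01) ≤ 1 / 2 * (∫ s, (U g s - f s) ^ 2 ∂mu01)
        + t * ((∫ s, U l s * edot p (D2mvec (U a s + U g s)) * U β s ∂mu01)
          + ∫ s, U l s * edot η (Dmvec (U a s + U g s)) ∂mu01) + C * t ^ 2 := by
  have hρ := one_sub_pos_of_lt hK
  set ρ := 1 - K * (4 / Real.pi ^ 2)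
  set c := ‖β‖ + (enorm2 η + K * ‖β‖) / ρ
  refine ⟨‖l‖ * (enorm2 η * c + enorm2 p * c ^ 2) + 1 / 2 * c ^ 2, fun t g' hg' => ?_⟩
  have h1 := norm_state_sub_le hg' hg hp
  rw [add_sub_cancel_left, add_sub_cancel_left, enorm2_smul, norm_smul, Real.norm_eq_abs] at h1
  have h2 : ‖g' - g‖ ≤ |t| * ((enorm2 η + K * ‖β‖) / ρ) := by
    rw [← mul_div_assoc, le_div_iff₀ hρ]
    linarith
  refine (tracking_le (D := |t| * c) hf hg hg' hl ?_).trans_eq ?_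
  · rw [mul_add]
    exact add_le_add_right h2 _
  · rw [mul_pow, sq_abs]
    linear_combination ‖l‖ * enorm2 η * c * sq_abs t

theorem first_variation {n : ℕ} {tb : Fin n → ℝ → ℝ} (htb : ∀ i, Continuous (tb i)) {ε γ K : ℝ}
    (hK : K < Real.pi ^ 2 / 4) {x : Hn n} (hx : Admissible x)
    (hmin : ∀ y : Hn n, Admissible y → cost tb ε γ x ≤ cost tb ε γ y)
    (hxK : ∀ i, enorm2 (x.1 i) < K) {l : Fin n → E}
    (hl : ∀ i, IsAdjSolF (U x.2.1) (x.1 i) (x.2.2 i) (tb i) (l i))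
    (η : Fin n → ℝ × ℝ) (β : E) :
    ε * inner ℝ x.2.1 β
      + ∑ i, ((∫ s, U (l i) s * edot (x.1 i) (D2mvec (U x.2.1 s + U (x.2.2 i) s)) * U β s ∂mu01)
        + ∫ s, U (l i) s * edot (η i) (Dmvec (U x.2.1 s + U (x.2.2 i) s)) ∂mu01)
      + γ * ∑ i, edot (x.1 i) (η i) = 0 := by
  obtain ⟨h, a, th⟩ := x
  dsimp only at *
  choose C hC using fun i =>
    exists_tracking_le (β := β) (η := η i) (htb i) hK (hxK i).le (hx i) (hl i)
  set G := ε * inner ℝ a β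
      + ∑ i, ((∫ s, U (l i) s * edot (h i) (D2mvec (U a s + U (th i) s)) * U β s ∂mu01)
        + ∫ s, U (l i) s * edot (η i) (Dmvec (U a s + U (th i) s)) ∂mu01)
      + γ * ∑ i, edot (h i) (η i) with hG
  set c := (∑ i, C i) + ε / 2 * ‖β‖ ^ 2 + γ / 2 * ∑ i, enorm2 (η i) ^ 2 with hc
  have hev : ∀ᶠ t : ℝ in 𝓝 0, ∀ i, enorm2 (h i + t • η i) < K := by
    refine eventually_all.2 fun i => ?_
    have : Continuous fun t : ℝ => enorm2 (h i + t • η i) := by fun_prop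
    refine this.continuousAt.eventually (gt_mem_nhds ?_)
    simpa using hxK i
  have hloc : IsLocalMin (fun t : ℝ => t * G + c * t ^ 2) 0 := by
    filter_upwards [hev] with t ht
    choose th' hth' using fun i => exists_state (a + t • β) ((ht i).trans hK)
    have h1 := hmin (fun i => h i + t • η i, a + t • β, th') hth'
    have h2 := Finset.sum_le_sum fun i (_ : i ∈ Finset.univ) => hC i t (th' i) (hth' i)
    have h3 : ‖a + t • β‖ ^ 2 = ‖a‖ ^ 2 + 2 * (t * inner ℝ a β) + t ^ 2 * ‖β‖ ^ 2 := by
      rw [norm_add_sq_real, real_inner_smul_right, norm_smul, mul_pow, Real.norm_eq_abs, sq_abs]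
    have h4 : ∀ i, enorm2 (h i + t • η i) ^ 2 =
        enorm2 (h i) ^ 2 + 2 * t * edot (h i) (η i) + t ^ 2 * enorm2 (η i) ^ 2 := fun i => by
      simp only [sq_enorm2, edot, Prod.fst_add, Prod.snd_add, Prod.smul_fst, Prod.smul_snd,
        smul_eq_mul]
      ring
    simp only [cost, integral_sq_eq_norm_sq, h3, h4, Finset.sum_add_distrib, ← Finset.mul_sum]
      at h1
    simp only [Finset.sum_add_distrib, ← Finset.mul_sum, ← Finset.sum_mul] at h2
    simp only [hG, hc, Finset.sum_add_distrib]
    linarith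
  have hder : HasDerivAt (fun t : ℝ => t * G + c * t ^ 2) G 0 := by
    refine (((hasDerivAt_id (0 : ℝ)).mul_const G).add
      (((hasDerivAt_id (0 : ℝ)).pow 2).const_mul c)).congr_deriv ?_
    simp
  exact hloc.hasDerivAt_eq_zero hder

theorem exists_multiplier {n : ℕ} {tb : Fin n → ℝ → ℝ} (htb : ∀ i, Continuous (tb i)) {ε γ K : ℝ}
    (hK : K < Real.pi ^ 2 / 4) {x : Hn n} (hx : Admissible x)
    (hmin : ∀ y : Hn n, Admissible y → cost tb ε γ x ≤ cost tb ε γ y)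
    (hxK : ∀ i, enorm2 (x.1 i) < K) : ∃ l, SolEQ tb ε γ x.1 x.2.1 x.2.2 l := by
  choose l hl using fun i => exists_adjoint x.2.1 (x.2.2 i) ((hxK i).trans hK) (htb i)
  have hvar := first_variation htb hK hx hmin hxK hl
  have hcomp : ∀ i q, (∫ s, U (l i) s * edot q (Dmvec (U x.2.1 s + U (x.2.2 i) s)) ∂mu01)
      + γ * edot (x.1 i) q = 0 := fun i q => by
    have h1 := hvar (Pi.single i q) 0
    have h0 : ∀ r, edot 0 r = 0 := fun r => by simp [edot]
    have h0' : ∀ r, edot r 0 = 0 := fun r => by simp [edot]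
    rw [Finset.sum_eq_single i, Finset.sum_eq_single i] at h1
    · simpa [U_zero] using h1
    all_goals simp +contextual [h0, h0', U_zero]
  refine ⟨l, hx, hl, fun w => ?_, fun i => ⟨?_, ?_⟩⟩
  · simpa [integral_mul_eq_inner, edot] using hvar 0 w
  · have := hcomp i (1, 0)
    simp only [edot, mul_one, mul_zero, add_zero, one_mul, zero_mul] at this
    linarith
  · have := hcomp i (0, 1)
    simp only [edot, mul_one, mul_zero, zero_add, one_mul, zero_mul] at this
    linarith

theorem intervalIntegral_eq_integral_mu01 (F : ℝ → ℝ) :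
    ∫ s in (0 : ℝ)..1, F s = ∫ s, F s ∂mu01 := by
  rw [intervalIntegral.integral_of_le zero_le_one, integral_Ioc_eq_integral_Ioo, mu01]

/-- The derivative of a weak solution is the primitive of the right-hand side. -/
theorem IsWeak.ae_eq {g : E} {F : ℝ → ℝ} (h : IsWeak g F) (hF : Continuous F) :
    (g : ℝ → ℝ) =ᵐ[mu01] fun t => ∫ s in t..1, F s := by
  set P : ℝ → ℝ := fun t => ∫ s in t..1, F s with hP
  have hPc : Continuous P := by
    have : P = fun t => -∫ s in (1 : ℝ)..t, F s :=
      funext fun t => intervalIntegral.integral_symm _ _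
    rw [this]
    exact (intervalIntegral.continuous_primitive (fun _ _ => hF.intervalIntegrable _ _) 1).neg
  have hPm : MemLp P 2 mu01 := by
    refine (memLp_two_iff_integrable_sq hPc.aestronglyMeasurable).2
      (integrable_of_continuous (by fun_prop))
  have hS : MeasurableSet {q : ℝ × ℝ | q.1 ≤ q.2} := measurableSet_le measurable_fst measurable_snd
  have hPi : ∀ t ∈ Ioo (0 : ℝ) 1, P t = ∫ s, (Ici t).indicator F s ∂mu01 := fun t ht => by
    rw [integral_indicator measurableSet_Ici, hP, mu01, Measure.restrict_restrict measurableSet_Ici]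
    dsimp only
    rw [intervalIntegral.integral_of_le ht.2.le, integral_Ioc_eq_integral_Ioo,
      ← integral_Ico_eq_integral_Ioo]
    congr 2
    ext s
    exact ⟨fun hs => ⟨hs.1, ht.1.trans_le hs.1, hs.2⟩, fun hs => ⟨hs.1, hs.2.2⟩⟩
  have hU : ∀ (w : E) s, U w s = ∫ t, (Iic s).indicator w t ∂mu01 := fun w s => by
    unfold U
    rw [← integral_indicator measurableSet_Ioc]
    refine integral_congr_ae (ae_mem_Ioo.mono fun t ht => ?_)
    by_cases hts : t ≤ s <;> simp [indicator, hts, ht.1]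
  have hinner : ∀ w : E, inner ℝ g w = inner ℝ (hPm.toLp P) w := fun w => by
    have hint : Integrable (Function.uncurry fun t s : ℝ =>
        {q : ℝ × ℝ | q.1 ≤ q.2}.indicator (fun q => w q.1 * F q.2) (t, s)) (mu01.prod mu01) :=
      ((integrable_coe w).mul_prod (integrable_of_continuous hF)).indicator hS
    have hswap := integral_integral_swap hint
    rw [h w, ← integral_mul_eq_inner]
    calc ∫ s, F s * U w s ∂mu01
        = ∫ s, ∫ t, {q : ℝ × ℝ | q.1 ≤ q.2}.indicator (fun q => w q.1 * F q.2) (t, s)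
            ∂mu01 ∂mu01 := by
          refine integral_congr_ae (.of_forall fun s => ?_)
          dsimp only
          rw [hU, ← integral_const_mul]
          refine integral_congr_ae (.of_forall fun t => ?_)
          by_cases hts : t ≤ s <;> simp [indicator, hts, mul_comm]
      _ = ∫ t, ∫ s, {q : ℝ × ℝ | q.1 ≤ q.2}.indicator (fun q => w q.1 * F q.2) (t, s)
            ∂mu01 ∂mu01 := hswap.symm
      _ = ∫ t, hPm.toLp P t * w t ∂mu01 := by
          refine integral_congr_ae ?_
          filter_upwards [ae_mem_Ioo, hPm.coeFn_toLp] with t ht ht'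
          rw [ht', hPi t ht, mul_comm, ← integral_const_mul]
          refine integral_congr_ae (.of_forall fun s => ?_)
          by_cases hts : t ≤ s <;> simp [indicator, hts]
  rw [ext_inner_right ℝ hinner]
  exact hPm.coeFn_toLp

theorem SolEQ.exists_continuous_version {n : ℕ} {tb : Fin n → ℝ → ℝ} {ε γ : ℝ} (hε : 0 < ε)
    {h : Fin n → ℝ × ℝ} {a : E} {th l : Fin n → E} (H : SolEQ tb ε γ h a th l) :
    ∃ g : ℝ → ℝ, Continuous g ∧ (a : ℝ → ℝ) =ᵐ[mu01] g ∧ g 0 = 0 := by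
  set F : ℝ → ℝ := fun s => -∑ i, U (l i) s * edot (h i) (D2mvec (U a s + U (th i) s)) with hF
  have hFc : Continuous F := by fun_prop
  have hw : IsWeak (ε • a) F := isWeak_design_iff.1 H.2.2.1
  refine ⟨fun t => ε⁻¹ * ∫ s in t..1, F s, ?_, ?_, ?_⟩
  · simp_rw [fun t : ℝ => intervalIntegral.integral_symm (μ := volume) (f := F) 1 t]
    exact ((intervalIntegral.continuous_primitive
      (fun _ _ => hFc.intervalIntegrable _ _) 1).neg).const_mul _
  · filter_upwards [hw.ae_eq hFc, Lp.coeFn_smul ε a] with t ht ht'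
    rw [← ht, ht', Pi.smul_apply, smul_eq_mul, inv_mul_cancel_left₀ hε.ne']
  · have hzero : ∀ i, ∫ s, U (l i) s * edot (h i) (D2mvec (U a s + U (th i) s)) ∂mu01 = 0 := by
      intro i
      obtain ⟨h1, h2⟩ := H.2.2.2 i
      have e : ∀ s, U (l i) s * edot (h i) (D2mvec (U a s + U (th i) s)) =
          (h i).2 * (U (l i) s * (Dmvec (U a s + U (th i) s)).1) -
          (h i).1 * (U (l i) s * (Dmvec (U a s + U (th i) s)).2) := fun s => by
        simp only [edot, D2mvec, Dmvec]; ring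
      simp_rw [e]
      rw [integral_sub (integrable_of_continuous (by fun_prop))
        (integrable_of_continuous (by fun_prop)), integral_const_mul, integral_const_mul]
      linear_combination (h i).2 * h1 - (h i).1 * h2
    dsimp only
    rw [intervalIntegral_eq_integral_mu01, hF, integral_neg,
      integral_finsetSum _ fun i _ => integrable_of_continuous (by fun_prop)]
    simp [hzero]

theorem cost_congr {n : ℕ} {tb tb' : Fin n → ℝ → ℝ} (h : ∀ i, EqOn (tb i) (tb' i) (Ioo 0 1))
    (ε γ : ℝ) : (cost tb ε γ : Hn n → ℝ) = cost tb' ε γ := by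
  funext x
  unfold cost
  congr 3
  refine Finset.sum_congr rfl fun i _ => integral_congr_ae (ae_mem_Ioo.mono fun s hs => ?_)
  simp only [h i hs]

theorem solEQ_congr {n : ℕ} {tb tb' : Fin n → ℝ → ℝ} (h : ∀ i, EqOn (tb i) (tb' i) (Ioo 0 1))
    (ε γ : ℝ) : SolEQ tb ε γ = SolEQ tb' ε γ := by
  funext p a th l
  have : ∀ i (w : E), ∫ s, (U (th i) s - tb i s) * U w s ∂mu01 =
      ∫ s, (U (th i) s - tb' i s) * U w s ∂mu01 := fun i w =>
    integral_congr_ae (ae_mem_Ioo.mono fun s hs => by simp only [h i hs])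
  simp only [SolEQ, IsAdjSolF, this]

theorem enorm2_lt_of_minimizer {n : ℕ} {tb : Fin n → ℝ → ℝ} {ε γ K : ℝ} (hε : 0 < ε) (hK : 0 < K)
    (hγ : (∑ i, ∫ s, (tb i s) ^ 2 ∂mu01) / K ^ 2 < γ) {x : Hn n}
    (hx : ∀ y : Hn n, Admissible y → cost tb ε γ x ≤ cost tb ε γ y) (i : Fin n) :
    enorm2 (x.1 i) < K := by
  have hΘ : 0 ≤ ∑ i, ∫ s, (tb i s) ^ 2 ∂mu01 :=
    Finset.sum_nonneg fun i _ => integral_nonneg fun s => sq_nonneg _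
  have hγ0 : 0 < γ := lt_of_le_of_lt (by positivity) hγ
  have h1 := mul_sq_enorm2_le_of_cost_le hε hγ0
    ((hx 0 (admissible_zero n)).trans_eq (cost_zero tb ε γ)) i
  rw [div_lt_iff₀ (by positivity)] at hγ
  refine lt_of_pow_lt_pow_left₀ 2 hK.le (lt_of_mul_lt_mul_left ?_ hγ0.le)
  linarith

/-- For large `γ` there is one minimizer, and it is the solution of (EQ) with `|hᵢ| ≤ K`. -/
theorem minimizer_unique_of_continuous {n : ℕ} {tb : Fin n → ℝ → ℝ} (htb : ∀ i, Continuous (tb i))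
    {B : ℝ} (hB : ∀ i s, |tb i s| ≤ B) {ε : ℝ} (hε : 0 < ε) {K : ℝ} (hK0 : 0 < K)
    (hK : K < Real.pi ^ 2 / 4) {γ : ℝ} (hγ : (∑ i, ∫ s, (tb i s) ^ 2 ∂mu01) / K ^ 2 < γ)
    (huniq : ∀ (h h' : Fin n → ℝ × ℝ) (a a' : E) (th th' l l' : Fin n → E),
      SolEQ tb ε γ h a th l → SolEQ tb ε γ h' a' th' l' →
      (∀ i, enorm2 (h i) ≤ K) → (∀ i, enorm2 (h' i) ≤ K) →
      h' = h ∧ a' = a ∧ th' = th ∧ l' = l) :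
    ∃ x : Hn n, Admissible x ∧
      (∀ y : Hn n, Admissible y → cost tb ε γ x ≤ cost tb ε γ y) ∧
      (∀ y : Hn n, Admissible y →
        (∀ z : Hn n, Admissible z → cost tb ε γ y ≤ cost tb ε γ z) → y = x) ∧
      ∃ l : Fin n → E, SolEQ tb ε γ x.1 x.2.1 x.2.2 l ∧ (∀ i, enorm2 (x.1 i) ≤ K) := by
  have hΘ : 0 ≤ ∑ i, ∫ s, (tb i s) ^ 2 ∂mu01 :=
    Finset.sum_nonneg fun i _ => integral_nonneg fun s => sq_nonneg _
  have hγ0 : 0 < γ := lt_of_le_of_lt (by positivity) hγ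
  obtain ⟨x, hx, hmin⟩ := exists_minimizer htb hB hε hγ0
  have hxK := enorm2_lt_of_minimizer hε hK0 hγ hmin
  obtain ⟨l, hl⟩ := exists_multiplier htb hK hx hmin hxK
  refine ⟨x, hx, hmin, fun y hy hymin => ?_, l, hl, fun i => (hxK i).le⟩
  have hyK := enorm2_lt_of_minimizer hε hK0 hγ hymin
  obtain ⟨l', hl'⟩ := exists_multiplier htb hK hy hymin hyK
  obtain ⟨h1, h2, h3, -⟩ := huniq _ _ _ _ _ _ _ _ hl hl' (fun i => (hxK i).le) fun i => (hyK i).le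
  exact Prod.ext h1 (Prod.ext h2 h3)

theorem exists_continuous_extension {n : ℕ} {tb : Fin n → ℝ → ℝ}
    (htb : ∀ i, ContinuousOn (tb i) (Icc (0 : ℝ) 1)) :
    ∃ (tb' : Fin n → ℝ → ℝ) (B : ℝ), (∀ i, Continuous (tb' i)) ∧ (∀ i s, |tb' i s| ≤ B) ∧ 0 ≤ B ∧
      ∀ i, EqOn (tb i) (tb' i) (Ioo 0 1) := by
  choose B hB using fun i => isCompact_Icc.exists_bound_of_continuousOn (htb i)
  have hBi : ∀ i, B i ≤ ∑ j, |B j| := fun i => (le_abs_self _).trans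
    (Finset.single_le_sum (f := fun j => |B j|) (fun j _ => abs_nonneg _) (Finset.mem_univ i))
  refine ⟨fun i => IccExtend zero_le_one (domRestrict (Icc (0 : ℝ) 1) (tb i)), ∑ j, |B j|,
    fun i => (htb i).domRestrict.Icc_extend', fun i s => ?_,
    Finset.sum_nonneg fun j _ => abs_nonneg _, fun i s hs => ?_⟩
  · exact (hB i _ (projIcc (0 : ℝ) 1 zero_le_one s).2).trans (hBi i)
  · exact (IccExtend_of_mem zero_le_one (domRestrict (Icc (0 : ℝ) 1) (tb i))
      (Ioo_subset_Icc_self hs)).symm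

end RodControl

/-- Theorem `coro-un`: for continuous targets, `ε > 0` and
`0 < K < π²/4`, there is `γ** = max{Θ̄²/K², γ*}` such that for every `γ > γ**` the
minimizer of `C` in `𝓐` is unique; it coincides, together with its Lagrange multiplier,
with the unique solution of (EQ) in `{maxᵢ|hᵢ| ≤ K}`, it is smooth with `α'(0) = 0`, and
`‖ϑᵢ‖_∞ ≤ |hᵢ|` for all `i`. -/
theorem minimizer_unique (n : ℕ)
    (tb : Fin n → ℝ → ℝ) (htb : ∀ i, ContinuousOn (tb i) (Icc (0:ℝ) 1))
    (ε : ℝ) (hε : 0 < ε) (K : ℝ) (hK0 : 0 < K) (hK : K < Real.pi ^ 2 / 4) :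
    ∃ γss : ℝ,
      -- one may take `γ** = max{Θ̄²/K², γ*}`, `γ*` a uniqueness threshold for (EQ):
      (∃ γstar : ℝ, γss = max ((∑ i, ∫ s, (tb i s) ^ 2 ∂mu01) / K ^ 2) γstar ∧
        ∀ γ : ℝ, γstar < γ →
          ∀ (h h' : Fin n → ℝ × ℝ) (a a' : E) (th th' l l' : Fin n → E),
            SolEQ tb ε γ h a th l → SolEQ tb ε γ h' a' th' l' →
            (∀ i, enorm2 (h i) ≤ K) → (∀ i, enorm2 (h' i) ≤ K) →
            h' = h ∧ a' = a ∧ th' = th ∧ l' = l) ∧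
      ∀ γ : ℝ, γss < γ →
        ∃ x : Hn n, Admissible x ∧
          -- `x` is a minimizer of `C` in `𝓐` ...
          (∀ y : Hn n, Admissible y → cost tb ε γ x ≤ cost tb ε γ y) ∧
          -- ... and it is the unique one:
          (∀ y : Hn n, Admissible y →
            (∀ z : Hn n, Admissible z → cost tb ε γ y ≤ cost tb ε γ z) → y = x) ∧
          ∃ l : Fin n → E,
            -- it solves (EQ), and is the unique solution of (EQ) in `{maxᵢ|hᵢ| ≤ K}`:
            SolEQ tb ε γ x.1 x.2.1 x.2.2 l ∧ (∀ i, enorm2 (x.1 i) ≤ K) ∧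
            (∀ (h' : Fin n → ℝ × ℝ) (a' : E) (th' l' : Fin n → E),
              SolEQ tb ε γ h' a' th' l' → (∀ i, enorm2 (h' i) ≤ K) →
              h' = x.1 ∧ a' = x.2.1 ∧ th' = x.2.2 ∧ l' = l) ∧
            -- smoothness of the design: `α'` has a continuous version with `α'(0) = 0`:
            (∃ g : ℝ → ℝ, ContinuousOn g (Icc (0:ℝ) 1) ∧
              (x.2.1 : ℝ → ℝ) =ᵐ[mu01] g ∧ g 0 = 0) ∧
            -- the bound `‖ϑᵢ‖_∞ ≤ |hᵢ|`:
            (∀ i, ∀ t ∈ Icc (0:ℝ) 1, |U (x.2.2 i) t| ≤ enorm2 (x.1 i)) := by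
  obtain ⟨tb', B, htb', hB, hB0, heq⟩ := RodControl.exists_continuous_extension htb
  have hΘ : ∑ i, ∫ s, (tb i s) ^ 2 ∂mu01 = ∑ i, ∫ s, (tb' i s) ^ 2 ∂mu01 :=
    Finset.sum_congr rfl fun i _ => integral_congr_ae
      (RodControl.ae_mem_Ioo.mono fun s hs => by simp only [heq i hs])
  obtain ⟨γstar, hstar⟩ := RodControl.exists_uniqueness_threshold htb' hB hB0 hε hK0 hK
  simp only [RodControl.cost_congr heq, RodControl.solEQ_congr heq, hΘ]
  refine ⟨_, ⟨γstar, rfl, hstar⟩, fun γ hγ => ?_⟩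
  have huniq := hstar γ ((le_max_right _ _).trans_lt hγ)
  obtain ⟨x, hx, hmin, hxu, l, hl, hxK⟩ := RodControl.minimizer_unique_of_continuous htb' hB hε
    hK0 hK ((le_max_left _ _).trans_lt hγ) huniq
  obtain ⟨g, hg, hag, hg0⟩ := RodControl.SolEQ.exists_continuous_version hε hl
  exact ⟨x, hx, hmin, hxu, l, hl, hxK,
    fun h' a' th' l' H' hK' => huniq _ _ _ _ _ _ _ _ hl H' hxK hK',
    ⟨g, hg.continuousOn, hag, hg0⟩,
    fun i t _ => (RodControl.abs_U_le _ t).trans (RodControl.norm_state_le (hx i))⟩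
end
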